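/- arXiv:math/9812022 — 2 statements merged into one kernel-verified Lean document; each statement's English description precedes it below -/
import Mathlib

section
/- Fix 1 ≤ a₀ ≤ n and j₀ ∈ ℤ_{≥1}. Let W be recorded by data ν^{(a)}_j supported in H_l, and define new data: W₁ increases ν^{(a₀)}_{j₀} by 2; W₂ increases ν^{(a₀)}_{j₀+1} and ν^{(a₀)}_{j₀−1} each by 1 (the factor with index j₀−1 = 0 being omitted when j₀ = 1); W₃ increases ν^{(b)}_{⌊(C_{b a₀} j₀ − k)/C_{a₀ b}⌋} by 1 for every b with C_{a₀ b} < 0 and every integer 0 ≤ k ≤ −C_{a₀ b} − 1 (indices equal to 0 omitted). Assume all indices occurring in W₁, W₂, W₃ satisfy j ≤ t_a l. Then for every λ ∈ P̄⁺ one has N_l(W₁,λ,q) = N_l(W₂,λ,q) + q^{−θ} N_l(W₃,λ,q), where θ = j₀ + Σ_{k=1}^{t_{a₀} l} ν^{(a₀)}_k min(j₀,k). -/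
open scoped BigOperators

namespace FermionicPaper

/-- The combinatorial data of a finite-dimensional simple Lie algebra `X_n` of type
`A_n, B_n, C_n, D_n, E_{6,7,8}, F_4, G_2`: the rank `n`, the numbers
`t_a = 2/(α_a|α_a) ∈ {1,2,3}` and the Cartan matrix `C_{ab} = t_a (α_a|α_b)`,
where `(·|·)` is the invariant bilinear form normalized by `(α|α) = 2` for long roots.
The axioms characterize exactly the Cartan data of the finite-dimensional simple Lie
algebras (symmetrizability, positive definiteness, connectedness, normalization). -/
structure CartanDatum (n : ℕ) : Type where
  t : Fin n → ℕ
  C : Fin n → Fin n → ℤ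
  t_pos : ∀ a, 0 < t a
  diag : ∀ a, C a a = 2
  offdiag_nonpos : ∀ a b, a ≠ b → C a b ≤ 0
  symm : ∀ a b, (t b : ℤ) * C a b = (t a : ℤ) * C b a
  posdef : ∀ v : Fin n → ℚ, v ≠ 0 → 0 < ∑ a, ∑ b, v a * ((C a b : ℚ) / (t a : ℚ)) * v b
  connected : ∀ S : Set (Fin n), S.Nonempty → (∀ a ∈ S, ∀ b, b ∉ S → C a b = 0) → ∀ a, a ∈ S
  normalized : ∃ a, t a = 1

variable {n : ℕ}

/-- The invariant form `(α_a | α_b)`. -/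
def CartanDatum.form (D : CartanDatum n) (a b : Fin n) : ℚ := (D.C a b : ℚ) / (D.t a : ℚ)

/-- `t = max_a t_a`. -/
def CartanDatum.tmax (D : CartanDatum n) : ℕ := Finset.univ.sup D.t

/-- The Cartan matrix as a rational matrix. -/
def CartanDatum.Cmat (D : CartanDatum n) : Matrix (Fin n) (Fin n) ℚ :=
  Matrix.of fun a b => (D.C a b : ℚ)

/-- The inverse Cartan matrix `C^{-1}`. -/
noncomputable def CartanDatum.Cinv (D : CartanDatum n) : Matrix (Fin n) (Fin n) ℚ := (D.Cmat)⁻¹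

/-- The invariant form on the weight space `P̄ ⊗ ℚ`, in the basis of fundamental weights;
`(Λ̄_a | Λ̄_b) = C^{-1}_{ab} / t_a`. -/
noncomputable def CartanDatum.wform (D : CartanDatum n) (μ ν : Fin n → ℚ) : ℚ :=
  ∑ a, ∑ b, μ a * (D.Cinv a b / (D.t a : ℚ)) * ν b

/-- The field `K = ℚ((q^{ℚ}))` of Hahn series in which all the `q`-series identities are stated. -/
abbrev K : Type := HahnSeries ℚ ℚ

/-- The monomial `q^c` for a rational exponent `c`. -/
noncomputable def hq (c : ℚ) : K := HahnSeries.single c 1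

/-- The extended `q`-binomial coefficient `{p+m choose m}` evaluated at `q^ε`
(`ε = 1` gives `q`, `ε = -1` gives `q^{-1}`); for `m ∈ ℤ_{≥0}` and integral `p` it equals
`(q^{p+1})_∞ (q^{m+1})_∞ / ((q)_∞ (q^{p+m+1})_∞) = ∏_{i=1}^m (1-q^{p+i})/(1-q^i)`. -/
noncomputable def qbinE (ε p : ℚ) (m : ℕ) : K :=
  ∏ i ∈ Finset.range m, (1 - hq (ε * (p + i + 1))) / (1 - hq (ε * (i + 1)))

/-- The truncated `q`-binomial coefficient `[p+m choose m]` at `q^ε`: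
it equals `{p+m choose m}` for `p ≥ 0` and `0` for `p < 0`. -/
noncomputable def qbinT (ε p : ℚ) (m : ℕ) : K := if 0 ≤ p then qbinE ε p m else 0

/-- `(q)_k = ∏_{j=1}^k (1 - q^j)`, at `q^ε`. -/
noncomputable def qpoch (ε : ℚ) (k : ℕ) : K := ∏ i ∈ Finset.range k, (1 - hq (ε * (i + 1)))

/-- `{p+m choose m}_1 = Γ(p+m+1)/(Γ(p+1)Γ(m+1)) = ∏_{i=1}^m (p+i)/i`, the `q = 1` value. -/
def bin1 (p : ℚ) (m : ℕ) : ℚ := ∏ i ∈ Finset.range m, (p + i + 1) / (i + 1)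

/-- A family `m^{(a)}_i` (or `ν^{(a)}_i`) has finitely many nonzero members. -/
def FinSupp (m : Fin n → ℕ → ℕ) : Prop :=
  (Function.support fun x : Fin n × ℕ => m x.1 x.2).Finite

variable (D : CartanDatum n)

/-- The vacancy numbers
`p^{(a)}_i = Σ_j ν^{(a)}_j min(i,j) − Σ_b (α_a|α_b) Σ_k min(t_b i, t_a k) m^{(b)}_k`. -/
noncomputable def pinf (ν m : Fin n → ℕ → ℕ) (a : Fin n) (i : ℕ) : ℚ :=
  (∑ᶠ j : ℕ, (ν a j : ℚ) * (min i j : ℕ))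
    - ∑ b, ∑ᶠ k : ℕ, D.form a b * (min (D.t b * i) (D.t a * k) : ℕ) * (m b k)

/-- The quadratic form
`c({m}) = ½ Σ_{a,b} (α_a|α_b) Σ_{j,k} min(t_b j, t_a k) m^{(a)}_j m^{(b)}_k
  − Σ_a Σ_{j,k} ν^{(a)}_j min(j,k) m^{(a)}_k` (allowing rational arguments `m`). -/
noncomputable def cinf (ν : Fin n → ℕ → ℕ) (m : Fin n → ℕ → ℚ) : ℚ :=
  (1/2) * (∑ a, ∑ b, ∑ᶠ j : ℕ, ∑ᶠ k : ℕ,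
      D.form a b * (min (D.t b * j) (D.t a * k) : ℕ) * m a j * m b k)
    - ∑ a, ∑ᶠ j : ℕ, ∑ᶠ k : ℕ, (ν a j : ℚ) * (min j k : ℕ) * m a k

/-- `c({m})` for integral `m`. -/
noncomputable def cinfN (ν m : Fin n → ℕ → ℕ) : ℚ := cinf D ν (fun a j => (m a j : ℚ))

/-- The constraint `Σ_{a,i} i m^{(a)}_i α_a = Σ_{a,i} i ν^{(a)}_i Λ̄_a − λ`, written in
the coordinates of the fundamental weight basis (`α_a = Σ_b C_{ba} Λ̄_b`). -/
def Constr (ν m : Fin n → ℕ → ℕ) (lam : Fin n → ℚ) : Prop :=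
  ∀ b, (∑ a, ∑ᶠ i : ℕ, (i : ℚ) * m a i * D.C b a) = (∑ᶠ i : ℕ, (i : ℚ) * ν b i) - lam b

/-- The admissible configurations for the fermionic form `M(W,λ,q)`. -/
def admM (ν : Fin n → ℕ → ℕ) (lam : Fin n → ℚ) : Set (Fin n → ℕ → ℕ) :=
  {m | FinSupp m ∧ Constr D ν m lam ∧ ∀ a, ∀ i : ℕ, 1 ≤ i → 0 ≤ pinf D ν m a i}

/-- The fermionic form `M(W,λ,q^ε)` for `W = ⊗_{a,j} (W^{(a)}_j)^{⊗ ν^{(a)}_j}` and `λ ∈ P̄`. -/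
noncomputable def M (ε : ℚ) (ν : Fin n → ℕ → ℕ) (lam : Fin n → ℚ) : K :=
  ∑ᶠ m ∈ admM D ν lam,
    hq (ε * cinfN D ν m) *
      ∏ᶠ a : Fin n, ∏ᶠ i ∈ {i : ℕ | 1 ≤ i}, qbinT ε (pinf D ν m a i) (m a i)

/-- Level-`l` restricted vacancy numbers (all indices restricted to `H_l`). -/
noncomputable def pl (l : ℕ) (ν m : Fin n → ℕ → ℕ) (a : Fin n) (i : ℕ) : ℚ :=
  (∑ j ∈ Finset.Icc 1 (D.t a * l), (ν a j : ℚ) * (min j i : ℕ))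
    - ∑ b, ∑ k ∈ Finset.Icc 1 (D.t b * l),
        D.form a b * (min (D.t b * i) (D.t a * k) : ℕ) * (m b k)

/-- Level-`l` restricted quadratic form `c_l({m})`. -/
noncomputable def cl (l : ℕ) (ν m : Fin n → ℕ → ℕ) : ℚ :=
  (1/2) * (∑ a, ∑ b, ∑ j ∈ Finset.Icc 1 (D.t a * l), ∑ k ∈ Finset.Icc 1 (D.t b * l),
      D.form a b * (min (D.t b * j) (D.t a * k) : ℕ) * (m a j) * (m b k))
    - ∑ a, ∑ j ∈ Finset.Icc 1 (D.t a * l), ∑ k ∈ Finset.Icc 1 (D.t a * l),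
        (ν a j : ℚ) * (min j k : ℕ) * (m a k)

/-- A family is supported in `H_l = {(a,j) | 1 ≤ j ≤ t_a l}`. -/
def SuppIn (l : ℕ) (m : Fin n → ℕ → ℕ) : Prop :=
  ∀ a j, m a j ≠ 0 → 1 ≤ j ∧ j ≤ D.t a * l

/-- Level-`l` constraint `Σ_{(a,i)∈H_l} i m^{(a)}_i α_a = Σ_{(a,i)∈H_l} i ν^{(a)}_i Λ̄_a − λ`. -/
def ConstrL (l : ℕ) (ν m : Fin n → ℕ → ℕ) (lam : Fin n → ℚ) : Prop :=
  ∀ b, (∑ a, ∑ i ∈ Finset.Icc 1 (D.t a * l), (i : ℚ) * m a i * D.C b a)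
      = (∑ i ∈ Finset.Icc 1 (D.t b * l), (i : ℚ) * ν b i) - lam b

/-- The level-`l` restricted fermionic form `M_l(W,q^ε)`. -/
noncomputable def Ml (ε : ℚ) (l : ℕ) (ν : Fin n → ℕ → ℕ) : K :=
  ∑ᶠ m ∈ {m | SuppIn D l m ∧ ConstrL D l ν m 0 ∧
      ∀ a, ∀ i ∈ Finset.Icc 1 (D.t a * l), 0 ≤ pl D l ν m a i},
    hq (ε * cl D l ν m) *
      ∏ a, ∏ i ∈ Finset.Icc 1 (D.t a * l), qbinT ε (pl D l ν m a i) (m a i)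

/-- The fermionic form `N_l(W,λ,q^ε)`: no positivity imposed on the vacancy numbers, and
extended `q`-binomial coefficients are used. -/
noncomputable def Nl (ε : ℚ) (l : ℕ) (ν : Fin n → ℕ → ℕ) (lam : Fin n → ℚ) : K :=
  ∑ᶠ m ∈ {m | SuppIn D l m ∧ ConstrL D l ν m lam},
    hq (ε * cl D l ν m) *
      ∏ a, ∏ i ∈ Finset.Icc 1 (D.t a * l), qbinE ε (pl D l ν m a i) (m a i)

/-- `N_∞(W,λ,q)` at `q = 1`. -/
noncomputable def Ninf1 (ν : Fin n → ℕ → ℕ) (lam : Fin n → ℚ) : ℚ :=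
  ∑ᶠ m ∈ {m | FinSupp m ∧ Constr D ν m lam},
    ∏ᶠ a : Fin n, ∏ᶠ i ∈ {i : ℕ | 1 ≤ i}, bin1 (pinf D ν m a i) (m a i)

/-- `N_l(W,λ,q)` at `q = 1`. -/
noncomputable def Nl1 (l : ℕ) (ν : Fin n → ℕ → ℕ) (lam : Fin n → ℚ) : ℚ :=
  ∑ᶠ m ∈ {m | SuppIn D l m ∧ ConstrL D l ν m lam},
    ∏ a, ∏ i ∈ Finset.Icc 1 (D.t a * l), bin1 (pl D l ν m a i) (m a i)

/-- The data of `W₁ = W^{(a₀)}_{j₀} ⊗ W^{(a₀)}_{j₀} ⊗ W`. -/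
def nu1 (ν : Fin n → ℕ → ℕ) (a₀ : Fin n) (j₀ : ℕ) : Fin n → ℕ → ℕ :=
  fun a j => ν a j + if a = a₀ ∧ j = j₀ then 2 else 0

/-- The data of `W₂ = W^{(a₀)}_{j₀+1} ⊗ W^{(a₀)}_{j₀−1} ⊗ W` (a factor with index `0`
being inert/omitted). -/
def nu2 (ν : Fin n → ℕ → ℕ) (a₀ : Fin n) (j₀ : ℕ) : Fin n → ℕ → ℕ :=
  fun a j => ν a j + (if a = a₀ ∧ j = j₀ + 1 then 1 else 0)
    + (if a = a₀ ∧ j = j₀ - 1 then 1 else 0)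

/-- The data of `W₃ = ⊗_{b ∼ a₀} ⊗_{k=0}^{-C_{a₀b}-1} W^{(b)}_{⌊(C_{b a₀} j₀ − k)/C_{a₀ b}⌋} ⊗ W`
(a factor with index `0` being inert/omitted); repeated indices are counted with
multiplicity. -/
def nu3 (ν : Fin n → ℕ → ℕ) (a₀ : Fin n) (j₀ : ℕ) : Fin n → ℕ → ℕ :=
  fun b j => ν b j +
    if D.C a₀ b < 0 then
      ((Finset.range (-(D.C a₀ b)).toNat).filter
        (fun k : ℕ => (((D.C b a₀) * (j₀ : ℤ) - (k : ℤ)).fdiv (D.C a₀ b)).toNat = j)).card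
    else 0


/-- The part of the vacancy number coming from `ν`. -/
noncomputable def Vv (l : ℕ) (ν : Fin n → ℕ → ℕ) (a : Fin n) (i : ℕ) : ℚ :=
  ∑ j ∈ Finset.Icc 1 (D.t a * l), (ν a j : ℚ) * (min j i : ℕ)

/-- The part of the vacancy number coming from `m`. -/
noncomputable def Pm (l : ℕ) (m : Fin n → ℕ → ℕ) (a : Fin n) (i : ℕ) : ℚ :=
  ∑ b, ∑ k ∈ Finset.Icc 1 (D.t b * l),
        D.form a b * (min (D.t b * i) (D.t a * k) : ℕ) * (m b k)

/-- The coupling to `(a₀, j₀)`. -/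
noncomputable def Gm (a₀ : Fin n) (j₀ : ℕ) (a : Fin n) (i : ℕ) : ℚ :=
  D.form a a₀ * (min (D.t a₀ * i) (D.t a * j₀) : ℕ)

/-- Increase `m` by one at `(a₀, j₀)`. -/
def bump (a₀ : Fin n) (j₀ : ℕ) (m : Fin n → ℕ → ℕ) : Fin n → ℕ → ℕ :=
  fun a j => m a j + if a = a₀ ∧ j = j₀ then 1 else 0

/-- The summand of the fermionic form. -/
noncomputable def Tm (l : ℕ) (ν m : Fin n → ℕ → ℕ) : K :=
  hq (1 * cl D l ν m) *
      ∏ a, ∏ i ∈ Finset.Icc 1 (D.t a * l), qbinE 1 (pl D l ν m a i) (m a i)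

lemma pl_eq (l : ℕ) (ν m : Fin n → ℕ → ℕ) (a : Fin n) (i : ℕ) :
    pl D l ν m a i = Vv D l ν a i - Pm D l m a i := rfl

lemma form_symm (a b : Fin n) : D.form a b = D.form b a := by
  unfold CartanDatum.form
  have h := D.symm a b
  have ha : (D.t a : ℚ) ≠ 0 := by exact_mod_cast (D.t_pos a).ne'
  have hb : (D.t b : ℚ) ≠ 0 := by exact_mod_cast (D.t_pos b).ne'
  rw [div_eq_div_iff ha hb]
  have : (D.t b : ℚ) * D.C a b = (D.t a : ℚ) * D.C b a := by exact_mod_cast h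
  linarith

lemma sum_bump (l : ℕ) (a₀ : Fin n) (j₀ : ℕ) (h1 : 1 ≤ j₀) (h2 : j₀ ≤ D.t a₀ * l)
    (f : Fin n → ℕ → ℚ) (c : ℚ) :
    ∑ a, ∑ j ∈ Finset.Icc 1 (D.t a * l), f a j * (if a = a₀ ∧ j = j₀ then c else 0)
      = f a₀ j₀ * c := by
  rw [Finset.sum_eq_single a₀]
  · rw [Finset.sum_eq_single j₀]
    · simp
    · intro b _ hb; simp [hb]
    · intro h; exact absurd (Finset.mem_Icc.2 ⟨h1, h2⟩) h
  · intro b _ hb; simp [hb]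
  · simp

lemma Pm_bump (l : ℕ) (a₀ : Fin n) (j₀ : ℕ) (h1 : 1 ≤ j₀) (h2 : j₀ ≤ D.t a₀ * l)
    (m : Fin n → ℕ → ℕ) (a : Fin n) (i : ℕ) :
    Pm D l (bump a₀ j₀ m) a i = Pm D l m a i + Gm D a₀ j₀ a i := by
  have := sum_bump D l a₀ j₀ h1 h2
    (fun b k => D.form a b * (min (D.t b * i) (D.t a * k) : ℕ)) 1
  unfold Pm Gm bump
  push_cast at this ⊢
  rw [mul_one] at this
  rw [← this, ← Finset.sum_add_distrib]
  refine Finset.sum_congr rfl fun b _ => ?_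
  rw [← Finset.sum_add_distrib]
  refine Finset.sum_congr rfl fun k _ => ?_
  ring

lemma cl_eq (l : ℕ) (ν m : Fin n → ℕ → ℕ) :
    cl D l ν m = (1/2) * (∑ a, ∑ j ∈ Finset.Icc 1 (D.t a * l), Pm D l m a j * m a j)
      - ∑ a, ∑ k ∈ Finset.Icc 1 (D.t a * l), Vv D l ν a k * m a k := by
  unfold cl Pm Vv
  congr 1
  · congr 1
    refine Finset.sum_congr rfl fun a _ => ?_
    rw [Finset.sum_comm]
    refine Finset.sum_congr rfl fun j _ => ?_
    rw [Finset.sum_mul]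
    refine Finset.sum_congr rfl fun b _ => ?_
    rw [Finset.sum_mul]
    refine Finset.sum_congr rfl fun k _ => ?_
    ring
  · refine Finset.sum_congr rfl fun a _ => ?_
    rw [Finset.sum_comm]
    refine Finset.sum_congr rfl fun k _ => ?_
    rw [Finset.sum_mul]

lemma Gm_self (a₀ : Fin n) (j₀ i : ℕ) : Gm D a₀ j₀ a₀ i = 2 * (min j₀ i : ℕ) := by
  unfold Gm CartanDatum.form
  have ha : (D.t a₀ : ℚ) ≠ 0 := by exact_mod_cast (D.t_pos a₀).ne'
  rw [D.diag, Nat.mul_min_mul_left, min_comm i j₀]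
  rw [Nat.cast_mul]
  field_simp
  push_cast
  ring

lemma sum_Gm (l : ℕ) (m : Fin n → ℕ → ℕ) (a₀ : Fin n) (j₀ : ℕ) :
    ∑ a, ∑ j ∈ Finset.Icc 1 (D.t a * l), Gm D a₀ j₀ a j * m a j = Pm D l m a₀ j₀ := by
  unfold Gm Pm
  refine Finset.sum_congr rfl fun a _ => Finset.sum_congr rfl fun j _ => ?_
  rw [form_symm D a a₀, min_comm]

lemma quad_bump (l : ℕ) (a₀ : Fin n) (j₀ : ℕ) (h1 : 1 ≤ j₀) (h2 : j₀ ≤ D.t a₀ * l)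
    (m : Fin n → ℕ → ℕ) :
    (∑ a, ∑ j ∈ Finset.Icc 1 (D.t a * l), Pm D l (bump a₀ j₀ m) a j * bump a₀ j₀ m a j)
      = (∑ a, ∑ j ∈ Finset.Icc 1 (D.t a * l), Pm D l m a j * m a j)
        + 2 * (∑ a, ∑ j ∈ Finset.Icc 1 (D.t a * l), Gm D a₀ j₀ a j * m a j) + 2 * j₀ := by
  have e1 := sum_bump D l a₀ j₀ h1 h2 (fun a j => Pm D l m a j + Gm D a₀ j₀ a j) 1
  rw [mul_one, Gm_self, min_self, ← sum_Gm D l m] at e1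
  have e2 : (∑ a, ∑ j ∈ Finset.Icc 1 (D.t a * l), Pm D l (bump a₀ j₀ m) a j * bump a₀ j₀ m a j)
      = (∑ a, ∑ j ∈ Finset.Icc 1 (D.t a * l), Pm D l m a j * m a j)
        + (∑ a, ∑ j ∈ Finset.Icc 1 (D.t a * l), Gm D a₀ j₀ a j * m a j)
        + ∑ a, ∑ j ∈ Finset.Icc 1 (D.t a * l),
          (Pm D l m a j + Gm D a₀ j₀ a j) * (if a = a₀ ∧ j = j₀ then 1 else 0) := by
    simp only [← Finset.sum_add_distrib]
    refine Finset.sum_congr rfl fun a _ => Finset.sum_congr rfl fun j _ => ?_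
    rw [Pm_bump D l a₀ j₀ h1 h2]
    unfold bump
    push_cast
    ring
  rw [e2, e1]; ring

lemma lin_bump (l : ℕ) (ν : Fin n → ℕ → ℕ) (a₀ : Fin n) (j₀ : ℕ) (h1 : 1 ≤ j₀)
    (h2 : j₀ ≤ D.t a₀ * l) (m : Fin n → ℕ → ℕ) :
    (∑ a, ∑ j ∈ Finset.Icc 1 (D.t a * l), Vv D l ν a j * bump a₀ j₀ m a j)
      = (∑ a, ∑ j ∈ Finset.Icc 1 (D.t a * l), Vv D l ν a j * m a j) + Vv D l ν a₀ j₀ := by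
  have e1 := sum_bump D l a₀ j₀ h1 h2 (fun a j => Vv D l ν a j) 1
  rw [mul_one] at e1
  rw [← e1]
  simp only [← Finset.sum_add_distrib]
  refine Finset.sum_congr rfl fun a _ => Finset.sum_congr rfl fun j _ => ?_
  unfold bump
  push_cast
  ring

lemma Vv_nu1 (l : ℕ) (ν : Fin n → ℕ → ℕ) (a₀ : Fin n) (j₀ : ℕ) (h1 : 1 ≤ j₀)
    (h2 : j₀ ≤ D.t a₀ * l) (a : Fin n) (i : ℕ) :
    Vv D l (nu1 ν a₀ j₀) a i = Vv D l ν a i + if a = a₀ then 2 * ((min j₀ i : ℕ) : ℚ) else 0 := by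
  unfold Vv nu1
  by_cases h : a = a₀
  · subst h
    simp only [true_and, if_true, Nat.cast_add, add_mul, Finset.sum_add_distrib]
    congr 1
    rw [Finset.sum_eq_single j₀]
    · simp
    · intro b _ hb; simp [hb]
    · intro h; exact absurd (Finset.mem_Icc.2 ⟨h1, h2⟩) h
  · simp [h]

lemma Vv_nu2 (l : ℕ) (ν : Fin n → ℕ → ℕ) (a₀ : Fin n) (j₀ : ℕ) (h1 : 1 ≤ j₀)
    (h2 : j₀ + 1 ≤ D.t a₀ * l) (a : Fin n) (i : ℕ) :
    Vv D l (nu2 ν a₀ j₀) a i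
      = Vv D l (nu1 ν a₀ j₀) a i - if a = a₀ ∧ i = j₀ then 1 else 0 := by
  rw [Vv_nu1 D l ν a₀ j₀ h1 (by omega)]
  unfold Vv nu2
  by_cases h : a = a₀
  · subst h
    simp only [true_and, if_true, Nat.cast_add, add_mul, Finset.sum_add_distrib]
    have e1 : ∑ j ∈ Finset.Icc 1 (D.t a * l),
        (((if j = j₀ + 1 then 1 else 0 : ℕ) : ℚ) * (min j i : ℕ)) = (min (j₀ + 1) i : ℕ) := by
      rw [Finset.sum_eq_single (j₀ + 1)]
      · simp
      · intro b _ hb; simp [hb]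
      · intro h; exact absurd (Finset.mem_Icc.2 ⟨by omega, h2⟩) h
    have e2 : ∑ j ∈ Finset.Icc 1 (D.t a * l),
        (((if j = j₀ - 1 then 1 else 0 : ℕ) : ℚ) * (min j i : ℕ)) = (min (j₀ - 1) i : ℕ) := by
      rw [Finset.sum_eq_single (j₀ - 1)]
      · simp
      · intro b _ hb; simp [hb]
      · intro h
        have : j₀ - 1 = 0 := by
          by_contra h'
          exact h (Finset.mem_Icc.2 ⟨by omega, by omega⟩)
        simp [this]
    rw [e1, e2]
    have e3 : min (j₀ + 1) i + min (j₀ - 1) i + (if i = j₀ then 1 else 0) = 2 * min j₀ i := by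
      split_ifs <;> omega
    have e4 : ((min (j₀ + 1) i : ℕ) : ℚ) + (min (j₀ - 1) i : ℕ) + (if i = j₀ then 1 else 0)
        = 2 * (min j₀ i : ℕ) := by exact_mod_cast e3
    linarith
  · simp [h]

lemma floor_sum (r x i : ℕ) :
    ∑ k ∈ Finset.range r, min ((x + k) / r) i = min x (r * i) := by
  rcases Nat.eq_zero_or_pos r with rfl | hr
  · simp
  by_cases h : r * i ≤ x
  · rw [min_eq_right h]
    rw [Finset.sum_congr rfl (g := fun _ => i)]
    · simp
    · intro k _
      apply min_eq_right
      rw [Nat.le_div_iff_mul_le hr]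
      nlinarith
  · push Not at h
    rw [min_eq_left h.le]
    rw [Finset.sum_congr rfl (g := fun k => (x + k) / r)]
    · clear h
      induction x with
      | zero =>
        apply Finset.sum_eq_zero
        intro k hk
        rw [zero_add]
        exact Nat.div_eq_of_lt (Finset.mem_range.1 hk)
      | succ x ih =>
        have e := Finset.sum_range_succ (fun k => (x + k) / r) r
        have e' := Finset.sum_range_succ' (fun k => (x + k) / r) r
        rw [ih] at e
        rw [e] at e'
        rw [Nat.add_div_right _ hr] at e'
        have : ∑ k ∈ Finset.range r, (x + 1 + k) / r = ∑ k ∈ Finset.range r, (x + (k + 1)) / r :=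
          Finset.sum_congr rfl fun k _ => by congr 1; omega
        rw [this]
        simp only [add_zero] at e'
        omega
    · intro k hk
      apply min_eq_left
      have hk := Finset.mem_range.1 hk
      have : (x + k) / r < i + 1 := by
        rw [Nat.div_lt_iff_lt_mul hr]
        nlinarith
      omega

lemma fdiv_nat (r s j k : ℕ) :
    ((-(s : ℤ)) * (j : ℤ) - (k : ℤ)).fdiv (-(r : ℤ)) = (((s * j + k) / r : ℕ) : ℤ) := by
  have : (-(s : ℤ)) * (j : ℤ) - (k : ℤ) = -((s * j + k : ℕ) : ℤ) := by push_cast; ring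
  rw [this, Int.neg_fdiv_neg, Int.fdiv_eq_ediv_of_nonneg _ (by positivity)]
  push_cast
  rfl

lemma Vv_nu3 (l : ℕ) (ν : Fin n → ℕ → ℕ) (a₀ : Fin n) (j₀ : ℕ) (h1 : 1 ≤ j₀)
    (h2 : j₀ + 1 ≤ D.t a₀ * l)
    (hb₃ : ∀ b : Fin n, D.C a₀ b < 0 → ∀ k : ℕ, (k : ℤ) < -(D.C a₀ b) →
      ((((D.C b a₀) * (j₀ : ℤ) - (k : ℤ)).fdiv (D.C a₀ b)).toNat) ≤ D.t b * l)
    (a : Fin n) (i : ℕ) :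
    Vv D l (nu3 D ν a₀ j₀) a i = Vv D l (nu1 ν a₀ j₀) a i - Gm D a₀ j₀ a i := by
  rw [Vv_nu1 D l ν a₀ j₀ h1 (by omega)]
  by_cases h : a = a₀
  · subst h
    rw [Gm_self, if_pos rfl, add_sub_cancel_right]
    unfold Vv nu3
    simp [D.diag]
  rw [if_neg h, add_zero]
  have hta : (D.t a : ℚ) ≠ 0 := by exact_mod_cast (D.t_pos a).ne'
  have hsym := D.symm a₀ a
  have hta0 := D.t_pos a
  have hta1 := D.t_pos a₀
  have hc1 := D.offdiag_nonpos a₀ a (Ne.symm h)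
  have hc2 := D.offdiag_nonpos a a₀ h
  obtain ⟨r, hr⟩ : ∃ r : ℕ, D.C a₀ a = -(r : ℤ) := ⟨(-(D.C a₀ a)).toNat, by omega⟩
  obtain ⟨s, hs⟩ : ∃ s : ℕ, D.C a a₀ = -(s : ℤ) := ⟨(-(D.C a a₀)).toNat, by omega⟩
  rw [hr, hs] at hsym
  have hsym' : D.t a * r = D.t a₀ * s := by
    have : (D.t a : ℤ) * r = D.t a₀ * s := by linarith
    exact_mod_cast this
  have hG : Gm D a₀ j₀ a i = - ((min (s * j₀) (r * i) : ℕ) : ℚ) := by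
    unfold Gm CartanDatum.form
    rw [hs]
    have e : D.t a * min (s * j₀) (r * i) = s * min (D.t a₀ * i) (D.t a * j₀) := by
      rw [← Nat.mul_min_mul_left, ← Nat.mul_min_mul_left, min_comm]
      congr 1
      · rw [← mul_assoc, hsym']; ring
      · ring
    have e' : (D.t a : ℚ) * (min (s * j₀) (r * i) : ℕ) = s * (min (D.t a₀ * i) (D.t a * j₀) : ℕ) := by
      exact_mod_cast e
    rw [eq_comm, div_mul_eq_mul_div, eq_div_iff hta]
    push_cast at e' ⊢
    linarith
  rw [hG, sub_neg_eq_add, ← floor_sum]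
  unfold Vv nu3
  simp only [Nat.cast_add, add_mul, Finset.sum_add_distrib]
  congr 1
  by_cases hr0 : r = 0
  · subst hr0
    simp [hr]
  have hneg : D.C a₀ a < 0 := by rw [hr]; omega
  have hb := hb₃ a hneg
  simp only [if_pos hneg]
  simp only [hr, hs, fdiv_nat, Int.toNat_natCast, neg_neg] at hb ⊢
  rw [Finset.sum_congr rfl (fun j _ => (Nat.cast_mul _ _).symm), ← Nat.cast_sum]
  congr 1
  simp only [Finset.card_filter, Finset.sum_mul]
  rw [Finset.sum_comm]
  refine Finset.sum_congr rfl fun k hk => ?_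
  have hk' := hb k (by exact_mod_cast Finset.mem_range.1 hk)
  rw [Finset.sum_eq_single ((s * j₀ + k) / r)]
  · simp
  · intro b _ hb; simp [Ne.symm hb]
  · intro h
    have : (s * j₀ + k) / r = 0 := by
      by_contra h'
      exact h (Finset.mem_Icc.2 ⟨Nat.one_le_iff_ne_zero.2 h', hk'⟩)
    simp [this]

lemma constr_iff (l : ℕ) (ν m : Fin n → ℕ → ℕ) (lam : Fin n → ℚ) :
    ConstrL D l ν m lam ↔ ∀ b, pl D l ν m b (D.t b * l) = lam b := by
  unfold ConstrL
  refine forall_congr' fun b => ?_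
  have e1 : (∑ i ∈ Finset.Icc 1 (D.t b * l), (i : ℚ) * ν b i) = Vv D l ν b (D.t b * l) := by
    unfold Vv
    refine Finset.sum_congr rfl fun j hj => ?_
    rw [min_eq_left (Finset.mem_Icc.1 hj).2, mul_comm]
  have e2 : (∑ a, ∑ i ∈ Finset.Icc 1 (D.t a * l), (i : ℚ) * m a i * D.C b a)
      = Pm D l m b (D.t b * l) := by
    unfold Pm CartanDatum.form
    refine Finset.sum_congr rfl fun a _ => Finset.sum_congr rfl fun j hj => ?_
    have hj := (Finset.mem_Icc.1 hj).2
    have htb : (D.t b : ℚ) ≠ 0 := by exact_mod_cast (D.t_pos b).ne'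
    rw [min_eq_right (by calc D.t b * j ≤ D.t b * (D.t a * l) := Nat.mul_le_mul_left _ hj
                          _ = D.t a * (D.t b * l) := by ring)]
    push_cast
    field_simp
  rw [e1, e2, pl_eq]
  constructor <;> intro h <;> linarith

lemma finite_adm (l : ℕ) (ν : Fin n → ℕ → ℕ) (lam : Fin n → ℚ) :
    {m | SuppIn D l m ∧ ConstrL D l ν m lam}.Finite := by
  rcases Set.eq_empty_or_nonempty {m | SuppIn D l m ∧ ConstrL D l ν m lam} with h | ⟨m₀, h0, h0'⟩
  · rw [h]; exact Set.finite_empty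
  let x : (Fin n → ℕ → ℕ) → Fin n → ℕ := fun m a => ∑ i ∈ Finset.Icc 1 (D.t a * l), i * m a i
  let B : Fin n → ℕ → ℕ := fun a j => if j ≤ D.t a * l then x m₀ a else 0
  have hx : ∀ m ∈ {m | SuppIn D l m ∧ ConstrL D l ν m lam}, x m = x m₀ := by
    rintro m ⟨_, hm⟩
    by_contra hne
    let v : Fin n → ℚ := fun a => (x m a : ℚ) - x m₀ a
    have hv : v ≠ 0 := by
      intro hv
      apply hne
      funext a
      have := congrFun hv a
      simp only [v, Pi.zero_apply, sub_eq_zero] at this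
      exact_mod_cast this
    have key : ∀ m', (∀ b, ∑ a, ∑ i ∈ Finset.Icc 1 (D.t a * l), (i : ℚ) * m' a i * D.C b a
        = ∑ a, (D.C b a : ℚ) * x m' a) := by
      intro m' b
      refine Finset.sum_congr rfl fun a _ => ?_
      simp only [x]
      push_cast
      rw [Finset.mul_sum]
      refine Finset.sum_congr rfl fun i _ => ?_
      ring
    have hC : ∀ b, ∑ a, (D.C b a : ℚ) * v a = 0 := by
      intro b
      have e := (hm b).trans (h0' b).symm
      rw [key, key] at e
      simp only [v, mul_sub, Finset.sum_sub_distrib]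
      linarith
    have hp := D.posdef v hv
    have : ∑ a, ∑ b, v a * ((D.C a b : ℚ) / (D.t a : ℚ)) * v b = 0 := by
      refine Finset.sum_eq_zero fun a _ => ?_
      have : ∑ b, v a * ((D.C a b : ℚ) / (D.t a : ℚ)) * v b
          = v a / D.t a * ∑ b, (D.C a b : ℚ) * v b := by
        rw [Finset.mul_sum]
        refine Finset.sum_congr rfl fun b _ => ?_
        ring
      rw [this, hC, mul_zero]
    linarith
  let N : ℕ := ∑ a, D.t a * l
  let X : ℕ := ∑ a, x m₀ a
  have hle : ∀ m ∈ {m | SuppIn D l m ∧ ConstrL D l ν m lam}, ∀ a j, m a j ≤ X := by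
    intro m hm a j
    by_cases hz : m a j = 0
    · omega
    obtain ⟨q1, q2⟩ := hm.1 a j hz
    calc m a j ≤ j * m a j := Nat.le_mul_of_pos_left _ q1
      _ ≤ x m a := Finset.single_le_sum (f := fun i => i * m a i) (fun _ _ => Nat.zero_le _)
          (Finset.mem_Icc.2 ⟨q1, q2⟩)
      _ = x m₀ a := by rw [hx m hm]
      _ ≤ X := Finset.single_le_sum (f := fun a => x m₀ a) (fun _ _ => Nat.zero_le _)
          (Finset.mem_univ a)
  have hN : ∀ a, D.t a * l ≤ N := fun a =>
    Finset.single_le_sum (f := fun a => D.t a * l) (fun _ _ => Nat.zero_le _) (Finset.mem_univ a)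
  let F : (Fin n → ℕ → ℕ) → (Fin n → Fin (N + 1) → Fin (X + 1)) :=
    fun m a j => Fin.ofNat (X + 1) (m a j)
  refine Set.Finite.of_injOn (f := F) (t := Set.univ) (fun _ _ => Set.mem_univ _) ?_
    Set.finite_univ
  intro m hm m' hm' hF
  funext a j
  by_cases hj : j ≤ N
  · have e := congrArg Fin.val (congrFun (congrFun hF a) ⟨j, by omega⟩)
    simp only [F, Fin.ofNat] at e
    rwa [Nat.mod_eq_of_lt (by have := hle m hm a j; omega),
      Nat.mod_eq_of_lt (by have := hle m' hm' a j; omega)] at e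
  · have z : ∀ m ∈ {m | SuppIn D l m ∧ ConstrL D l ν m lam}, m a j = 0 := by
      intro m hm
      by_contra hz
      have := (hm.1 a j hz).2
      have := hN a
      omega
    rw [z m hm, z m' hm']

lemma hq_add (a b : ℚ) : hq (a + b) = hq a * hq b := by
  unfold hq
  rw [HahnSeries.single_mul_single, one_mul]

lemma hq_zero : hq 0 = 1 := rfl

lemma one_sub_hq_ne {c : ℚ} (hc : c ≠ 0) : (1 : K) - hq c ≠ 0 := by
  intro h
  have h' : (1 : K) = hq c := sub_eq_zero.1 h
  have := congrArg (fun f : K => f.coeff c) h'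
  simp [hq, HahnSeries.coeff_one, hc] at this

lemma qbin_shift (p : ℚ) (m : ℕ) :
    qbinE 1 (p - 1) m * (1 - hq (p + m)) = qbinE 1 p m * (1 - hq p) := by
  induction m with
  | zero => simp [qbinE]
  | succ m ih =>
    unfold qbinE at ih ⊢
    rw [Finset.prod_range_succ, Finset.prod_range_succ]
    have e1 : (1 : ℚ) * (p - 1 + m + 1) = p + m := by ring
    have e2 : (1 : ℚ) * (p + m + 1) = p + (m + 1 : ℕ) := by push_cast; ring
    rw [e1, e2]
    linear_combination ((1 - hq (p + (m + 1 : ℕ))) / (1 - hq (1 * (m + 1)))) * ih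

lemma qbin_succ (p : ℚ) (m : ℕ) :
    qbinE 1 p (m + 1) * (1 - hq (m + 1)) = qbinE 1 p m * (1 - hq (p + m + 1)) := by
  unfold qbinE
  rw [Finset.prod_range_succ]
  simp only [one_mul]
  have := one_sub_hq_ne (c := (m : ℚ) + 1) (by positivity)
  field_simp

lemma qbin_pascal (p : ℚ) (m : ℕ) :
    qbinE 1 p (m + 1) = hq (m + 1) * qbinE 1 (p - 1) (m + 1) + qbinE 1 p m := by
  have hne := one_sub_hq_ne (c := (m : ℚ) + 1) (by positivity)
  apply mul_right_cancel₀ hne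
  have h1 := qbin_succ p m
  have h2 := qbin_succ (p - 1) m
  have h3 := qbin_shift p m
  have e : p - 1 + m + 1 = p + m := by ring
  rw [e] at h2
  have e' : hq (p + m + 1) = hq p * hq (m + 1) := by rw [← hq_add]; congr 1; ring
  rw [e'] at h1
  linear_combination h1 - hq (m + 1) * h2 - hq (m + 1) * h3

lemma Tm_zero (l : ℕ) (ν : Fin n → ℕ → ℕ) (a₀ : Fin n) (j₀ : ℕ) (h1 : 1 ≤ j₀)
    (h2 : j₀ + 1 ≤ D.t a₀ * l) (m : Fin n → ℕ → ℕ) (hm : m a₀ j₀ = 0) :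
    Tm D l (nu1 ν a₀ j₀) m = Tm D l (nu2 ν a₀ j₀) m := by
  unfold Tm
  refine congrArg₂ (· * ·) (congrArg (fun c => hq (1 * c)) ?_) ?_
  · rw [cl_eq, cl_eq]
    congr 1
    refine Finset.sum_congr rfl fun a _ => Finset.sum_congr rfl fun j _ => ?_
    rw [Vv_nu2 D l ν a₀ j₀ h1 h2]
    split_ifs with h
    · rw [h.1, h.2, hm]; simp
    · simp
  · refine Finset.prod_congr rfl fun a _ => Finset.prod_congr rfl fun j _ => ?_
    rw [pl_eq, pl_eq, Vv_nu2 D l ν a₀ j₀ h1 h2]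
    split_ifs with h
    · rw [h.1, h.2, hm]; simp [qbinE]
    · simp

lemma prod_split (l : ℕ) (a₀ : Fin n) (j₀ : ℕ) (h1 : 1 ≤ j₀) (h2 : j₀ ≤ D.t a₀ * l)
    (f : Fin n → ℕ → K) :
    ∏ a, ∏ i ∈ Finset.Icc 1 (D.t a * l), f a i = f a₀ j₀ *
      ∏ x ∈ (Finset.univ.sigma fun a => Finset.Icc 1 (D.t a * l)).erase ⟨a₀, j₀⟩, f x.1 x.2 := by
  have h := Finset.mul_prod_erase (Finset.univ.sigma fun a => Finset.Icc 1 (D.t a * l))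
    (fun x : (_ : Fin n) × ℕ => f x.1 x.2) (a := ⟨a₀, j₀⟩) (by simp; omega)
  rw [h, Finset.prod_sigma]

lemma Tm_bump (l : ℕ) (ν : Fin n → ℕ → ℕ) (a₀ : Fin n) (j₀ : ℕ) (h1 : 1 ≤ j₀)
    (h2 : j₀ + 1 ≤ D.t a₀ * l)
    (hb₃ : ∀ b : Fin n, D.C a₀ b < 0 → ∀ k : ℕ, (k : ℤ) < -(D.C a₀ b) →
      ((((D.C b a₀) * (j₀ : ℤ) - (k : ℤ)).fdiv (D.C a₀ b)).toNat) ≤ D.t b * l)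
    (m : Fin n → ℕ → ℕ) :
    Tm D l (nu1 ν a₀ j₀) (bump a₀ j₀ m) = Tm D l (nu2 ν a₀ j₀) (bump a₀ j₀ m)
      + hq (-((j₀ + ∑ k ∈ Finset.Icc 1 (D.t a₀ * l), ν a₀ k * min j₀ k : ℕ) : ℚ))
            * Tm D l (nu3 D ν a₀ j₀) m := by
  have h2' : j₀ ≤ D.t a₀ * l := by omega
  have hθ : ((j₀ + ∑ k ∈ Finset.Icc 1 (D.t a₀ * l), ν a₀ k * min j₀ k : ℕ) : ℚ)
      = j₀ + Vv D l ν a₀ j₀ := by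
    unfold Vv
    rw [Nat.cast_add, Nat.cast_sum]
    congr 1
    refine Finset.sum_congr rfl fun k _ => ?_
    rw [Nat.cast_mul, min_comm]
  rw [hθ]
  have hV1 : Vv D l (nu1 ν a₀ j₀) a₀ j₀ = Vv D l ν a₀ j₀ + 2 * j₀ := by
    rw [Vv_nu1 D l ν a₀ j₀ h1 h2']; simp
  have c2 : cl D l (nu2 ν a₀ j₀) (bump a₀ j₀ m)
      = cl D l (nu1 ν a₀ j₀) (bump a₀ j₀ m) + (m a₀ j₀ + 1) := by
    have hs := sum_bump D l a₀ j₀ h1 h2' (fun a j => (bump a₀ j₀ m a j : ℚ)) 1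
    have hbm : ((bump a₀ j₀ m a₀ j₀ : ℕ) : ℚ) = m a₀ j₀ + 1 := by simp [bump]
    rw [hbm, mul_one] at hs
    have : ∑ a, ∑ k ∈ Finset.Icc 1 (D.t a * l), Vv D l (nu2 ν a₀ j₀) a k * bump a₀ j₀ m a k
      = (∑ a, ∑ k ∈ Finset.Icc 1 (D.t a * l), Vv D l (nu1 ν a₀ j₀) a k * bump a₀ j₀ m a k)
        - (m a₀ j₀ + 1) := by
      rw [← hs]
      simp only [← Finset.sum_sub_distrib]
      refine Finset.sum_congr rfl fun a _ => Finset.sum_congr rfl fun j _ => ?_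
      rw [Vv_nu2 D l ν a₀ j₀ h1 h2]
      ring
    rw [cl_eq, cl_eq, this]; ring
  have c3 : cl D l (nu1 ν a₀ j₀) (bump a₀ j₀ m)
      = -(j₀ + Vv D l ν a₀ j₀) + cl D l (nu3 D ν a₀ j₀) m := by
    have : ∑ a, ∑ k ∈ Finset.Icc 1 (D.t a * l), Vv D l (nu3 D ν a₀ j₀) a k * m a k
      = (∑ a, ∑ k ∈ Finset.Icc 1 (D.t a * l), Vv D l (nu1 ν a₀ j₀) a k * m a k)
        - ∑ a, ∑ j ∈ Finset.Icc 1 (D.t a * l), Gm D a₀ j₀ a j * m a j := by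
      simp only [← Finset.sum_sub_distrib]
      refine Finset.sum_congr rfl fun a _ => Finset.sum_congr rfl fun j _ => ?_
      rw [Vv_nu3 D l ν a₀ j₀ h1 h2 hb₃]
      ring
    rw [cl_eq, cl_eq, this, quad_bump D l a₀ j₀ h1 h2', lin_bump D l _ a₀ j₀ h1 h2', hV1]
    ring
  have p3 : ∀ a i, pl D l (nu3 D ν a₀ j₀) m a i = pl D l (nu1 ν a₀ j₀) (bump a₀ j₀ m) a i := by
    intro a i
    rw [pl_eq, pl_eq, Vv_nu3 D l ν a₀ j₀ h1 h2 hb₃, Pm_bump D l a₀ j₀ h1 h2']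
    ring
  have p2 : ∀ a i, pl D l (nu2 ν a₀ j₀) (bump a₀ j₀ m) a i
      = pl D l (nu1 ν a₀ j₀) (bump a₀ j₀ m) a i - if a = a₀ ∧ i = j₀ then 1 else 0 := by
    intro a i
    rw [pl_eq, pl_eq, Vv_nu2 D l ν a₀ j₀ h1 h2]
    ring
  unfold Tm
  simp only [p3, p2]
  rw [← mul_assoc, ← hq_add, one_mul, one_mul, one_mul, ← c3, c2, hq_add]
  rw [prod_split D l a₀ j₀ h1 h2', prod_split D l a₀ j₀ h1 h2', prod_split D l a₀ j₀ h1 h2']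
  have hb0 : bump a₀ j₀ m a₀ j₀ = m a₀ j₀ + 1 := by simp [bump]
  have q2 : ∏ x ∈ (Finset.univ.sigma fun a => Finset.Icc 1 (D.t a * l)).erase ⟨a₀, j₀⟩,
      qbinE 1 (pl D l (nu1 ν a₀ j₀) (bump a₀ j₀ m) x.1 x.2
        - if x.1 = a₀ ∧ x.2 = j₀ then 1 else 0) (bump a₀ j₀ m x.1 x.2)
      = ∏ x ∈ (Finset.univ.sigma fun a => Finset.Icc 1 (D.t a * l)).erase ⟨a₀, j₀⟩,
      qbinE 1 (pl D l (nu1 ν a₀ j₀) (bump a₀ j₀ m) x.1 x.2) (m x.1 x.2) := by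
    refine Finset.prod_congr rfl fun x hx => ?_
    have hx' : ¬ (x.1 = a₀ ∧ x.2 = j₀) := by
      rintro ⟨rfl, rfl⟩
      exact (Finset.ne_of_mem_erase hx) rfl
    simp [bump, hx']
  have q1 : ∏ x ∈ (Finset.univ.sigma fun a => Finset.Icc 1 (D.t a * l)).erase ⟨a₀, j₀⟩,
      qbinE 1 (pl D l (nu1 ν a₀ j₀) (bump a₀ j₀ m) x.1 x.2) (bump a₀ j₀ m x.1 x.2)
      = ∏ x ∈ (Finset.univ.sigma fun a => Finset.Icc 1 (D.t a * l)).erase ⟨a₀, j₀⟩,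
      qbinE 1 (pl D l (nu1 ν a₀ j₀) (bump a₀ j₀ m) x.1 x.2) (m x.1 x.2) := by
    refine Finset.prod_congr rfl fun x hx => ?_
    have hx' : ¬ (x.1 = a₀ ∧ x.2 = j₀) := by
      rintro ⟨rfl, rfl⟩
      exact (Finset.ne_of_mem_erase hx) rfl
    simp [bump, hx']
  rw [q1, q2, hb0, if_pos ⟨rfl, rfl⟩, qbin_pascal]
  ring

lemma adm12 (l : ℕ) (ν : Fin n → ℕ → ℕ) (a₀ : Fin n) (j₀ : ℕ) (h1 : 1 ≤ j₀)
    (h2 : j₀ + 1 ≤ D.t a₀ * l) (m : Fin n → ℕ → ℕ) (lam : Fin n → ℚ) :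
    ConstrL D l (nu2 ν a₀ j₀) m lam ↔ ConstrL D l (nu1 ν a₀ j₀) m lam := by
  rw [constr_iff, constr_iff]
  refine forall_congr' fun b => ?_
  rw [pl_eq, pl_eq, Vv_nu2 D l ν a₀ j₀ h1 h2, if_neg, sub_zero]
  rintro ⟨rfl, h⟩
  omega

lemma adm13 (l : ℕ) (ν : Fin n → ℕ → ℕ) (a₀ : Fin n) (j₀ : ℕ) (h1 : 1 ≤ j₀)
    (h2 : j₀ + 1 ≤ D.t a₀ * l)
    (hb₃ : ∀ b : Fin n, D.C a₀ b < 0 → ∀ k : ℕ, (k : ℤ) < -(D.C a₀ b) →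
      ((((D.C b a₀) * (j₀ : ℤ) - (k : ℤ)).fdiv (D.C a₀ b)).toNat) ≤ D.t b * l)
    (m : Fin n → ℕ → ℕ) (lam : Fin n → ℚ) :
    ConstrL D l (nu3 D ν a₀ j₀) m lam ↔ ConstrL D l (nu1 ν a₀ j₀) (bump a₀ j₀ m) lam := by
  rw [constr_iff, constr_iff]
  refine forall_congr' fun b => ?_
  rw [pl_eq, pl_eq, Vv_nu3 D l ν a₀ j₀ h1 h2 hb₃, Pm_bump D l a₀ j₀ h1 (by omega)]
  constructor <;> intro h <;> linarith

lemma supp_bump (l : ℕ) (a₀ : Fin n) (j₀ : ℕ) (h1 : 1 ≤ j₀)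
    (h2 : j₀ ≤ D.t a₀ * l) (m : Fin n → ℕ → ℕ) :
    SuppIn D l (bump a₀ j₀ m) ↔ SuppIn D l m := by
  constructor
  · intro h a j hm
    exact h a j (by unfold bump; omega)
  · intro h a j hm
    by_cases hx : a = a₀ ∧ j = j₀
    · rw [hx.1, hx.2]; exact ⟨h1, h2⟩
    · exact h a j (by simpa [bump, hx] using hm)

lemma bump_inj (a₀ : Fin n) (j₀ : ℕ) : Function.Injective (bump a₀ j₀) := by
  intro m m' h
  funext a j
  have := congrFun (congrFun h a) j
  unfold bump at this
  omega

lemma exists_bump (a₀ : Fin n) (j₀ : ℕ) (m : Fin n → ℕ → ℕ) (h : m a₀ j₀ ≠ 0) :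
    ∃ m', bump a₀ j₀ m' = m := by
  refine ⟨fun a j => m a j - if a = a₀ ∧ j = j₀ then 1 else 0, ?_⟩
  funext a j
  by_cases hx : a = a₀ ∧ j = j₀
  · simp only [bump, if_pos hx]
    rw [hx.1, hx.2]; omega
  · simp only [bump, if_neg hx]
    simp

/-- Theorem: recursion relation for the fermionic form `N_l`.
For `W` recorded by data `ν` supported in `H_l`, `W₁, W₂, W₃` as above with all
occurring indices satisfying `j ≤ t_a l`, and any `λ ∈ P̄⁺`, one has
`N_l(W₁,λ,q) = N_l(W₂,λ,q) + q^{−θ} N_l(W₃,λ,q)` with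
`θ = j₀ + Σ_{k=1}^{t_{a₀} l} ν^{(a₀)}_k min(j₀,k)`. -/
theorem statement2 (n : ℕ) (D : CartanDatum n) (l : ℕ) (hl : 1 ≤ l)
    (ν : Fin n → ℕ → ℕ) (hν : SuppIn D l ν)
    (a₀ : Fin n) (j₀ : ℕ) (hj₀ : 1 ≤ j₀)
    (hb₁ : j₀ + 1 ≤ D.t a₀ * l)
    (hb₃ : ∀ b : Fin n, D.C a₀ b < 0 → ∀ k : ℕ, (k : ℤ) < -(D.C a₀ b) →
      ((((D.C b a₀) * (j₀ : ℤ) - (k : ℤ)).fdiv (D.C a₀ b)).toNat) ≤ D.t b * l)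
    (lam : Fin n → ℤ) (hlam : ∀ a, 0 ≤ lam a) :
    Nl D 1 l (nu1 ν a₀ j₀) (fun a => (lam a : ℚ))
      = Nl D 1 l (nu2 ν a₀ j₀) (fun a => (lam a : ℚ))
        + hq (-((j₀ + ∑ k ∈ Finset.Icc 1 (D.t a₀ * l), ν a₀ k * min j₀ k : ℕ) : ℚ))
            * Nl D 1 l (nu3 D ν a₀ j₀) (fun a => (lam a : ℚ)) := by
  have hS2 : {m | SuppIn D l m ∧ ConstrL D l (nu2 ν a₀ j₀) m (fun a => (lam a : ℚ))}
      = {m | SuppIn D l m ∧ ConstrL D l (nu1 ν a₀ j₀) m (fun a => (lam a : ℚ))} := by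
    ext m
    simp only [Set.mem_ofPred_eq, adm12 D l ν a₀ j₀ hj₀ hb₁]
  have hfin1 := finite_adm D l (nu1 ν a₀ j₀) (fun a => (lam a : ℚ))
  have hfin3 := finite_adm D l (nu3 D ν a₀ j₀) (fun a => (lam a : ℚ))
  have hN : ∀ ν', Nl D 1 l ν' (fun a => (lam a : ℚ))
      = ∑ᶠ m ∈ {m | SuppIn D l m ∧ ConstrL D l ν' m (fun a => (lam a : ℚ))}, Tm D l ν' m :=
    fun _ => rfl
  rw [hN, hN, hN, hS2]
  set S1 := {m | SuppIn D l m ∧ ConstrL D l (nu1 ν a₀ j₀) m (fun a => (lam a : ℚ))} with hS1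
  set S3 := {m | SuppIn D l m ∧ ConstrL D l (nu3 D ν a₀ j₀) m (fun a => (lam a : ℚ))} with hS3
  have hsub : ∑ᶠ m ∈ S1, (Tm D l (nu1 ν a₀ j₀) m - Tm D l (nu2 ν a₀ j₀) m)
      = ∑ᶠ m ∈ S1, Tm D l (nu1 ν a₀ j₀) m - ∑ᶠ m ∈ S1, Tm D l (nu2 ν a₀ j₀) m :=
    finsum_mem_sub_distrib _ _ hfin1
  rw [← sub_eq_iff_eq_add', ← hsub, ← smul_eq_mul, smul_finsum_mem hfin3]
  have himg : ∑ᶠ m ∈ S1, (Tm D l (nu1 ν a₀ j₀) m - Tm D l (nu2 ν a₀ j₀) m)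
      = ∑ᶠ m ∈ bump a₀ j₀ '' S3, (Tm D l (nu1 ν a₀ j₀) m - Tm D l (nu2 ν a₀ j₀) m) := by
    apply finsum_mem_inter_support_eq
    ext m
    simp only [Set.mem_inter_iff, Function.mem_support]
    refine and_congr_left fun hm => ?_
    have hm0 : m a₀ j₀ ≠ 0 := fun h => hm (sub_eq_zero.2 (Tm_zero D l ν a₀ j₀ hj₀ hb₁ m h))
    obtain ⟨m', rfl⟩ := exists_bump a₀ j₀ m hm0
    rw [(bump_inj a₀ j₀).mem_set_image, hS1, hS3, Set.mem_ofPred_eq, Set.mem_ofPred_eq,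
      supp_bump D l a₀ j₀ hj₀ (by omega), adm13 D l ν a₀ j₀ hj₀ hb₁ hb₃]
  rw [himg, finsum_mem_image ((bump_inj a₀ j₀).injOn)]
  refine finsum_mem_congr rfl fun m _ => ?_
  rw [Tm_bump D l ν a₀ j₀ hj₀ hb₁ hb₃, add_sub_cancel_left, smul_eq_mul]

end FermionicPaper
end

section
/- Let X_n = B_n (n ≥ 2) and let χ^{(a)}_j be the character sums defined in the context. Then the χ^{(a)}_j satisfy the Q-system of type B_n: (χ^{(a)}_j)² = χ^{(a)}_{j−1}χ^{(a)}_{j+1} + χ^{(a−1)}_j χ^{(a+1)}_j for 1 ≤ a ≤ n−2 and j ≥ 1; (χ^{(n−1)}_j)² = χ^{(n−1)}_{j−1}χ^{(n−1)}_{j+1} + χ^{(n−2)}_j χ^{(n)}_{2j} for j ≥ 1; (χ^{(n)}_{2j})² = χ^{(n)}_{2j−1}χ^{(n)}_{2j+1} + (χ^{(n−1)}_j)² for j ≥ 1; and (χ^{(n)}_{2j+1})² = χ^{(n)}_{2j}χ^{(n)}_{2j+2} + χ^{(n−1)}_j χ^{(n−1)}_{j+1} for j ≥ 0, where χ^{(0)}_j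 = 1 for all j and χ^{(a)}_0 = 1 for all a. -/
open scoped BigOperators

namespace FermionicPaperBn

/-! ### Characters of the simple Lie algebra `B_n` as functions on the Cartan subalgebra.

Weights are written in the `ε`-coordinates: a weight `μ = Σ_i μ_i ε_i` is the vector
`(μ_1,…,μ_n) ∈ ℚ^n` (half-integer entries occur for spin weights).  For
`h = (h_1,…,h_n)` (so `y_i = e^{h_i}`), `e^{μ}(h) = exp(Σ_i μ_i h_i)`.  The Weyl group
of `B_n` consists of signed permutations; characters are given by the Weyl character
formula.  -/

variable (n : ℕ)

/-- `e^{μ}` as a function of `h`. -/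
noncomputable def ew (μ : Fin n → ℚ) (h : Fin n → ℝ) : ℝ :=
  Real.exp (∑ i, (μ i : ℝ) * h i)

/-- The Weyl numerator `Σ_{w} (det w) e^{(wμ)}(h)`, the sum over the Weyl group of
`B_n` = signed permutations `w = (σ,ε)` with `det w = sgn(σ) ε_1 ⋯ ε_n`. -/
noncomputable def anum (μ : Fin n → ℚ) (h : Fin n → ℝ) : ℝ :=
  ∑ σ : Equiv.Perm (Fin n), ∑ ε : Fin n → Bool,
    ((Equiv.Perm.sign σ : ℤ) : ℝ) * (∏ i, (if ε i then (1:ℝ) else -1)) *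
      Real.exp (∑ i, (μ i : ℝ) * (if ε i then (1:ℝ) else -1) * h (σ i))

/-- `ρ` of `B_n` in `ε`-coordinates: `(n−1/2, n−3/2, …, 1/2)`. -/
def rhoB : Fin n → ℚ := fun i => (n : ℚ) - (i : ℚ) - 1/2

/-- The irreducible character `ch V(μ)` of `B_n` with highest weight `μ`
(in `ε`-coordinates), by the Weyl character formula. -/
noncomputable def chB (μ : Fin n → ℚ) (h : Fin n → ℝ) : ℝ :=
  anum n (fun i => μ i + rhoB n i) h / anum n (rhoB n) h

/-- The fundamental weight `Λ̄_c` of `B_n` (`1 ≤ c ≤ n`, paper indexing; `Λ̄_0 = 0`)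
in `ε`-coordinates: `Λ̄_c = ε_1 + ⋯ + ε_c` for `c < n` and `Λ̄_n = (ε_1+⋯+ε_n)/2`. -/
def fwB (c : ℕ) : Fin n → ℚ :=
  if c = 0 then 0
  else if c = n then fun _ => 1/2
  else fun i => if (i : ℕ) < c then 1 else 0

/-- `t_a` for `B_n` (paper indexing `1 ≤ a ≤ n`): `t_a = 1` for `a < n`, `t_n = 2`. -/
def tpap (a : ℕ) : ℕ := if a = n then 2 else 1

/-- The character sums
`χ^{(a)}_j = Σ ch V(k_{a₀}Λ̄_{a₀} + k_{a₀+2}Λ̄_{a₀+2} + ⋯ + k_aΛ̄_a)`,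
the sum over nonnegative integers `k_{a₀}, k_{a₀+2}, …, k_a`
(`a₀ ∈ {0,1}`, `a₀ ≡ a (mod 2)`) with `t_a(k_{a₀}+⋯+k_{a−2}) + k_a = j`. -/
noncomputable def chiB (a j : ℕ) (h : Fin n → ℝ) : ℝ :=
  ∑ᶠ k ∈ {k : ℕ → ℕ | (∀ c, k c ≠ 0 → c ≤ a ∧ c % 2 = a % 2) ∧
      tpap n a * (∑ᶠ c ∈ {c : ℕ | c ≠ a}, k c) + k a = j},
    chB n (fun i => ∑ᶠ c : ℕ, (k c : ℚ) * fwB n c i) h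


section abstractPart
set_option linter.unusedSectionVars false

variable {ι : Type} [Fintype ι] (c x : ι → ℝ)

/-- The `a`-fold tensor power of the functional `f ↦ ∑ t, c t * f t`. -/
noncomputable def Lf (a : ℕ) (f : (Fin a → ι) → ℝ) : ℝ := ∑ τ, (∏ j, c (τ j)) * f τ

/-- Monomials. -/
noncomputable def mon {a : ℕ} (r : Fin a → ℤ) (τ : Fin a → ι) : ℝ := ∏ j, x (τ j) ^ (r j)

/-- Antisymmetric functions of tuples. -/
def AntiF {a : ℕ} (φ : (Fin a → ι) → ℝ) : Prop :=
  ∀ (σ : Equiv.Perm (Fin a)) (τ : Fin a → ι), φ (τ ∘ σ) = ((Equiv.Perm.sign σ : ℤ) : ℝ) * φ τ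

/-- Vanishing condition at the exponent `r`. -/
def VanF {a : ℕ} (φ : (Fin a → ι) → ℝ) (r : ℤ) : Prop :=
  ∀ (j : Fin a) (τ : Fin a → ι), ∑ t, c t * x t ^ r * φ (Function.update τ j t) = 0

noncomputable def Kf (a : ℕ) (τ : Fin a → ι) : ℝ :=
  ∏ i, ∏ j ∈ Finset.Ioi i, (1 - (x (τ i))⁻¹ * (x (τ j))⁻¹)

noncomputable def Pf : (a : ℕ) → (m d : ℕ) → (Fin a → ι) → ℝ
  | 0, _, _, _ => 1
  | (a+1), m, d, τ => if a % 2 = 0 then x (τ 0) ^ ((m:ℤ) - d) * Pf a m (d+1) (Fin.tail τ)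
      else ∑ i ∈ Finset.range (m+1), x (τ 0) ^ ((i:ℤ) - d) * Pf a i (d+1) (Fin.tail τ)

lemma Lf_perm {a : ℕ} {φ : (Fin a → ι) → ℝ} (hφ : AntiF φ) (σ : Equiv.Perm (Fin a))
    (r : Fin a → ℤ) :
    Lf c a (fun τ => φ τ * mon x (r ∘ σ) τ)
      = ((Equiv.Perm.sign σ : ℤ) : ℝ) * Lf c a (fun τ => φ τ * mon x r τ) := by
  unfold Lf
  rw [← (Equiv.arrowCongr σ⁻¹ (Equiv.refl ι)).sum_comp, Finset.mul_sum]
  refine Finset.sum_congr rfl fun τ _ => ?_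
  have e : (Equiv.arrowCongr σ⁻¹ (Equiv.refl ι)) τ = τ ∘ σ := by
    ext; simp [Equiv.arrowCongr]; rfl
  rw [e]
  beta_reduce
  rw [hφ]
  have h1 : ∏ j, c ((τ ∘ σ) j) = ∏ j, c (τ j) := Equiv.prod_comp σ (fun j => c (τ j))
  have h2 : mon x (r ∘ σ) (τ ∘ σ) = mon x r τ := by
    unfold mon; exact Equiv.prod_comp σ (fun j => x (τ j) ^ r j)
  rw [h1, h2]; ring

lemma Lf_eq {a : ℕ} {φ : (Fin a → ι) → ℝ} (hφ : AntiF φ) (r : Fin a → ℤ) {i j : Fin a}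
    (hij : i ≠ j) (hr : r i = r j) : Lf c a (fun τ => φ τ * mon x r τ) = 0 := by
  have h := Lf_perm c x hφ (Equiv.swap i j) r
  have e : r ∘ (Equiv.swap i j) = r := by
    ext k
    simp only [Function.comp]
    rcases eq_or_ne k i with rfl | h1
    · simp [hr]
    rcases eq_or_ne k j with rfl | h2
    · simp [hr]
    · rw [Equiv.swap_apply_of_ne_of_ne h1 h2]
  rw [e, Equiv.Perm.sign_swap hij] at h
  norm_num at h
  linarith

lemma Lf_van {a : ℕ} {φ : (Fin a → ι) → ℝ} {r0 : ℤ} (hφ : VanF c x φ r0) (r : Fin a → ℤ) (j : Fin a)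
    (hr : r j = r0) : Lf c a (fun τ => φ τ * mon x r τ) = 0 := by
  obtain ⟨a, rfl⟩ : ∃ b, a = b + 1 := ⟨a - 1, by have := j.2; omega⟩
  unfold Lf mon
  rw [← (Fin.insertNthEquiv (fun _ => ι) j).sum_comp, Fintype.sum_prod_type, Finset.sum_comm]
  refine Finset.sum_eq_zero fun τ _ => ?_
  rcases isEmpty_or_nonempty ι with he | ⟨⟨t0⟩⟩
  · simp
  have h := hφ j (j.insertNth t0 τ)
  have h2 := congrArg (fun z => (∏ k, c (τ k)) * (∏ k, x (τ k) ^ r (j.succAbove k)) * z) h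
  simp only [mul_zero] at h2
  rw [← h2, Finset.mul_sum]
  refine Finset.sum_congr rfl fun t _ => ?_
  simp only [Fin.insertNthEquiv_apply, Fin.prod_univ_succAbove _ j, Fin.insertNth_apply_same,
    Fin.insertNth_apply_succAbove, hr, Fin.update_insertNth]
  simp only [Fin.insertNthEquiv, Equiv.coe_fn_mk, Fin.insertNth_apply_same,
    Fin.insertNth_apply_succAbove]
  ring

lemma Lf_succ {a : ℕ} (f : (Fin (a+1) → ι) → ℝ) :
    Lf c (a+1) f = ∑ t, c t * Lf c a (fun τ => f (Fin.cons t τ)) := by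
  unfold Lf
  rw [← (Fin.consEquiv (fun _ => ι)).sum_comp, Fintype.sum_prod_type]
  refine Finset.sum_congr rfl fun t _ => ?_
  rw [Finset.mul_sum]
  refine Finset.sum_congr rfl fun τ _ => ?_
  simp [Fin.consEquiv, Fin.prod_univ_succ]
  ring

lemma Lf_sum {a : ℕ} {κ : Type} (s : Finset κ) (f : κ → (Fin a → ι) → ℝ) :
    Lf c a (fun τ => ∑ k ∈ s, f k τ) = ∑ k ∈ s, Lf c a (f k) := by
  unfold Lf
  simp only [Finset.mul_sum]
  rw [Finset.sum_comm]

lemma Lf_mul {a : ℕ} (k : ℝ) (f : (Fin a → ι) → ℝ) :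
    Lf c a (fun τ => k * f τ) = k * Lf c a f := by
  unfold Lf
  rw [Finset.mul_sum]
  exact Finset.sum_congr rfl fun τ _ => by ring

lemma Kf_succ {a : ℕ} (τ : Fin (a+1) → ι) : Kf x (a+1) τ
    = (∏ j : Fin a, (1 - (x (τ 0))⁻¹ * (x (τ j.succ))⁻¹)) * Kf x a (Fin.tail τ) := by
  unfold Kf
  rw [Fin.prod_univ_succ]
  simp only [Fin.prod_Ioi_zero, Fin.prod_Ioi_succ]
  rfl

/-- exponent vector after choosing a subset. -/
def rS {a : ℕ} (M : ℤ) (S : Finset (Fin a)) : Fin (a+1) → ℤ :=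
  Fin.cons (M - S.card) (fun j => M - 1 - (j:ℕ) - if j ∈ S then 1 else 0)

lemma rS_zero {a : ℕ} (M : ℤ) (S : Finset (Fin a)) : rS M S 0 = M - S.card := rfl

lemma rS_succ {a : ℕ} (M : ℤ) (S : Finset (Fin a)) (j : Fin a) :
    rS M S j.succ = M - 1 - (j:ℕ) - if j ∈ S then 1 else 0 := rfl

lemma prod_expand {a : ℕ} (hx : ∀ t, x t ≠ 0) (M : ℤ) (τ : Fin (a+1) → ι) :
    (∏ j : Fin a, (1 - (x (τ 0))⁻¹ * (x (τ j.succ))⁻¹)) * mon x (fun j => M - (j:ℕ)) τ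
     = ∑ S : Finset (Fin a), (-1)^S.card * mon x (rS M S) τ := by
  have h := Finset.prod_add (fun j : Fin a => - ((x (τ 0))⁻¹ * (x (τ j.succ))⁻¹)) (fun _ => 1) Finset.univ
  have h' : ∏ j : Fin a, (1 - (x (τ 0))⁻¹ * (x (τ j.succ))⁻¹)
     = ∑ S : Finset (Fin a), ∏ j ∈ S, (- ((x (τ 0))⁻¹ * (x (τ j.succ))⁻¹)) := by
    rw [← Finset.powerset_univ]
    simp only [Finset.prod_const_one, mul_one] at h
    rw [← h]
    exact Finset.prod_congr rfl fun j _ => by ring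
  rw [h', Finset.sum_mul]
  refine Finset.sum_congr rfl fun S _ => ?_
  unfold mon rS
  rw [Fin.prod_univ_succ, Fin.prod_univ_succ]
  simp only [Fin.cons_zero, Fin.cons_succ]
  have e1 : ∏ j ∈ S, (- ((x (τ 0))⁻¹ * (x (τ j.succ))⁻¹))
     = (-1)^S.card * ((x (τ 0)) ^ (-(S.card:ℤ)) * ∏ j : Fin a, x (τ j.succ) ^ (-(if j ∈ S then (1:ℤ) else 0))) := by
    have : ∏ j : Fin a, x (τ j.succ) ^ (-(if j ∈ S then (1:ℤ) else 0)) = ∏ j ∈ S, (x (τ j.succ))⁻¹ := by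
      rw [← Finset.prod_subset (Finset.subset_univ S)]
      · exact Finset.prod_congr rfl fun j hj => by simp [hj]
      · intro j _ hj; simp [hj]
    rw [this]
    simp only [neg_mul_eq_neg_mul, Finset.prod_mul_distrib, Finset.prod_const, zpow_neg, zpow_natCast]
    rw [neg_eq_neg_one_mul, mul_pow, inv_pow]; ring
  rw [e1]
  have e2 : ∏ j : Fin a, x (τ j.succ) ^ (M - 1 - ((j:ℕ):ℤ) - if j ∈ S then (1:ℤ) else 0)
     = (∏ j : Fin a, x (τ j.succ) ^ (-(if j ∈ S then (1:ℤ) else 0))) * ∏ j : Fin a, x (τ j.succ) ^ (M - ((j.succ:ℕ):ℤ)) := by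
    rw [← Finset.prod_mul_distrib]
    refine Finset.prod_congr rfl fun j _ => ?_
    rw [← zpow_add₀ (hx _)]
    congr 1
    simp; ring
  rw [e2, sub_eq_add_neg M (S.card:ℤ), zpow_add₀ (hx _)]
  simp
  ring

lemma rS_coll {a : ℕ} (M : ℤ) (S : Finset (Fin a)) (hS : S.Nonempty)
    (hS2 : ¬ (2 * S.card = a + 1 ∧ ∀ j : Fin a, j ∈ S ↔ a ≤ S.card + j)) :
    ∃ i j, i ≠ j ∧ rS M S i = rS M S j := by
  by_contra! hcon
  have hup : ∀ j : ℕ, ∀ (h1 : j + 1 < a), (⟨j, by omega⟩ : Fin a) ∈ S → (⟨j+1, h1⟩ : Fin a) ∈ S := by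
    intro j h1 hj
    by_contra hj'
    refine hcon (Fin.succ ⟨j, by omega⟩) (Fin.succ ⟨j+1, h1⟩) (by simp) ?_
    rw [rS_succ, rS_succ, if_pos hj, if_neg hj']; push_cast; ring
  have hup2 : ∀ d j : ℕ, ∀ (h1 : j + d < a), (⟨j, by omega⟩ : Fin a) ∈ S → (⟨j+d, h1⟩ : Fin a) ∈ S := by
    intro d
    induction d with
    | zero => intro j h1 h; exact h
    | succ d ih => intro j h1 h; exact hup (j+d) (by omega) (ih j (by omega) h)
  have hSI : S = Finset.Ici (S.min' hS) := by
    ext j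
    rw [Finset.mem_Ici]
    constructor
    · intro h; exact Finset.min'_le S j h
    · intro h
      have := hup2 (j - (S.min' hS : ℕ)) (S.min' hS) (by have := j.2; have : (S.min' hS : ℕ) ≤ j := h; omega) (Finset.min'_mem S hS)
      convert this using 1
      ext
      have : (S.min' hS : ℕ) ≤ j := h
      simp; omega
  set t := S.min' hS with ht
  have hcard : S.card = a - t := by
    rw [hSI]; simp
  have hta := t.2
  have hmem : ∀ j : Fin a, j ∈ S ↔ a ≤ S.card + j := by
    intro j
    rw [hcard]
    conv_lhs => rw [hSI, Finset.mem_Ici]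
    rw [Fin.le_def]; omega
  have hne : 2 * S.card ≠ a + 1 := fun h => hS2 ⟨h, hmem⟩
  have hpos : 1 ≤ S.card := hS.card_pos
  have hle : S.card ≤ a := by omega
  rcases Nat.lt_or_gt_of_ne hne with hlt | hgt
  · refine hcon 0 (Fin.succ ⟨S.card - 1, by omega⟩) (by simp [Fin.ext_iff]) ?_
    have : (⟨S.card - 1, by omega⟩ : Fin a) ∉ S := by rw [hmem]; simp; omega
    rw [rS_zero, rS_succ, if_neg this]; push_cast [Nat.cast_sub hpos]; ring
  · refine hcon 0 (Fin.succ ⟨S.card - 2, by omega⟩) (by simp [Fin.ext_iff]) ?_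
    have : (⟨S.card - 2, by omega⟩ : Fin a) ∈ S := by rw [hmem]; simp; omega
    have h2 : 2 ≤ S.card := by omega
    rw [rS_zero, rS_succ, if_pos this]; push_cast [Nat.cast_sub h2]; ring

lemma Lf_step {a : ℕ} (hx : ∀ t, x t ≠ 0) {φ : (Fin (a+1) → ι) → ℝ} (hφ : AntiF φ) (M : ℤ) :
    Lf c (a+1) (fun τ => φ τ * ((∏ j : Fin a, (1 - (x (τ 0))⁻¹ * (x (τ j.succ))⁻¹))
        * mon x (fun j => M - (j:ℕ)) τ))
     = Lf c (a+1) (fun τ => φ τ * mon x (fun j => M - (j:ℕ)) τ)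
       - if a % 2 = 0 then 0 else Lf c (a+1) (fun τ => φ τ * mon x (fun j => M - 1 - (j:ℕ)) τ) := by
  simp only [prod_expand x hx, Finset.mul_sum]
  rw [Lf_sum]
  have hterm : ∀ S : Finset (Fin a), Lf c (a+1) (fun τ => φ τ * ((-1)^S.card * mon x (rS M S) τ))
     = (-1)^S.card * Lf c (a+1) (fun τ => φ τ * mon x (rS M S) τ) := by
    intro S
    rw [← Lf_mul]; congr 1; funext τ; ring
  have h0 : rS M (∅ : Finset (Fin a)) = (fun j : Fin (a+1) => M - ((j:ℕ):ℤ)) := by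
    funext j
    refine Fin.cases ?_ (fun j => ?_) j
    · simp [rS]
    · simp [rS]; ring
  simp only [hterm]
  split_ifs with ha
  · rw [Finset.sum_eq_single ∅]
    · simp [h0]
    · intro S _ hS
      obtain ⟨i, j, hij, hr⟩ := rS_coll M S (Finset.nonempty_iff_ne_empty.2 hS) (by omega)
      rw [Lf_eq c x hφ _ hij hr, mul_zero]
    · simp
  · obtain ⟨i, rfl⟩ : ∃ i, a = 2 * i + 1 := ⟨a / 2, by omega⟩
    set S0 : Finset (Fin (2*i+1)) := Finset.univ.filter (fun j => i ≤ (j:ℕ)) with hS0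
    have hc : S0.card = i + 1 := by
      have : S0 = Finset.Ici ⟨i, by omega⟩ := by
        ext j; simp [hS0, Fin.le_def]
      rw [this]; simp; omega
    rw [Finset.sum_eq_add ∅ S0]
    · have h1 : rS M S0 = (fun j : Fin (2*i+1+1) => M - 1 - ((j:ℕ):ℤ)) ∘
          ((Fin.cycleRange (⟨i, by omega⟩ : Fin (2*i+1+1)))⁻¹ : Equiv.Perm (Fin (2*i+1+1))) := by
        funext j
        refine Fin.cases ?_ (fun j => ?_) j
        · simp only [Function.comp, Equiv.Perm.inv_def]
          rw [Fin.cycleRange_symm_zero]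
          simp [rS, hc]; ring
        · simp only [Function.comp, Equiv.Perm.inv_def]
          rw [Fin.cycleRange_symm_succ]
          by_cases hj : (j:ℕ) < i
          · rw [Fin.succAbove_of_castSucc_lt _ _ (by simpa [Fin.lt_def] using hj)]
            simp [rS, hS0, hj]
          · rw [Fin.succAbove_of_le_castSucc _ _ (by simpa [Fin.le_def] using hj)]
            simp [rS, hS0, not_lt.1 hj]; ring
      rw [h0, h1, Lf_perm c x hφ, hc, Equiv.Perm.sign_inv, Fin.sign_cycleRange]
      simp only [Finset.card_empty, pow_zero, one_mul]
      push_cast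
      rw [← mul_assoc, ← pow_add, show i + 1 + i = 2 * i + 1 by ring, pow_succ, pow_mul]
      norm_num
      ring
    · intro h
      rw [← h] at hc; simp at hc
    · rintro S _ ⟨hS, hS'⟩
      obtain ⟨i, j, hij, hr⟩ := rS_coll M S (Finset.nonempty_iff_ne_empty.2 hS) (by
        rintro ⟨h1, h2⟩
        apply hS'
        ext j
        rw [h2, hS0]; simp; omega)
      rw [Lf_eq c x hφ _ hij hr, mul_zero]
    · simp
    · simp

end abstractPart
section abstractPart2
set_option linter.unusedSectionVars false
variable {ι : Type} [Fintype ι] (c x : ι → ℝ)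

lemma anti_cons {a : ℕ} {φ : (Fin (a+1) → ι) → ℝ} (hφ : AntiF φ) (t : ι) :
    AntiF (fun τ : Fin a → ι => φ (Fin.cons t τ) * ∏ j, (1 - (x t)⁻¹ * (x (τ j))⁻¹)) := by
  intro σ τ
  have h := hφ (Equiv.Perm.decomposeFin.symm (0, σ)) (Fin.cons t τ)
  have e : (Fin.cons t τ : Fin (a+1) → ι) ∘ (Equiv.Perm.decomposeFin.symm (0, σ)) = Fin.cons t (τ ∘ σ) := by
    funext j
    refine Fin.cases ?_ (fun j => ?_) j
    · simp
    · simp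
  rw [e, Equiv.Perm.decomposeFin.symm_sign] at h
  simp only [if_true, one_mul] at h
  have h2 : ∏ j, (1 - (x t)⁻¹ * (x ((τ ∘ σ) j))⁻¹) = ∏ j, (1 - (x t)⁻¹ * (x (τ j))⁻¹) :=
    Equiv.prod_comp σ (fun j => (1 - (x t)⁻¹ * (x (τ j))⁻¹))
  beta_reduce
  rw [h, h2, mul_assoc]

lemma van_cons {a : ℕ} (hx : ∀ t, x t ≠ 0) {φ : (Fin (a+1) → ι) → ℝ} {r : ℤ} (h1 : VanF c x φ r)
    (h2 : VanF c x φ (r-1)) (t : ι) :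
    VanF c x (fun τ : Fin a → ι => φ (Fin.cons t τ) * ∏ j, (1 - (x t)⁻¹ * (x (τ j))⁻¹)) r := by
  intro j τ
  have e1 := h1 j.succ (Fin.cons t τ)
  have e2 := h2 j.succ (Fin.cons t τ)
  simp only [← Fin.cons_update] at e1 e2
  have hp : ∀ s, ∏ k, (1 - (x t)⁻¹ * (x (Function.update τ j s k))⁻¹)
     = (1 - (x t)⁻¹ * (x s)⁻¹) * ∏ k ∈ Finset.univ.erase j, (1 - (x t)⁻¹ * (x (τ k))⁻¹) := by
    intro s
    rw [← Finset.mul_prod_erase _ _ (Finset.mem_univ j)]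
    congr 1
    · simp
    · refine Finset.prod_congr rfl fun k hk => ?_
      rw [Function.update_of_ne (Finset.ne_of_mem_erase hk)]
  set Q := ∏ k ∈ Finset.univ.erase j, (1 - (x t)⁻¹ * (x (τ k))⁻¹) with hQ
  have : ∑ s, c s * x s ^ r * (φ (Fin.cons t (Function.update τ j s)) * ∏ k, (1 - (x t)⁻¹ * (x (Function.update τ j s k))⁻¹))
    = Q * (∑ s, c s * x s ^ r * φ (Fin.cons t (Function.update τ j s)))
     - Q * (x t)⁻¹ * ∑ s, c s * x s ^ (r-1) * φ (Fin.cons t (Function.update τ j s)) := by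
    rw [Finset.mul_sum, Finset.mul_sum, ← Finset.sum_sub_distrib]
    refine Finset.sum_congr rfl fun s _ => ?_
    rw [hp, zpow_sub_one₀ (hx s)]; ring
  rw [this, e1, e2]; ring

/-- one top row peeled off. -/
lemma Lf_peel {a : ℕ} (hx : ∀ t, x t ≠ 0) {φ : (Fin (a+1) → ι) → ℝ} (hφ : AntiF φ) (m d : ℕ)
    (ih : ∀ t, Lf c a (fun τ => (φ (Fin.cons t τ) * ∏ j, (1 - (x t)⁻¹ * (x (τ j))⁻¹)) * Kf x a τ * Pf x a m (d+1) τ)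
      = Lf c a (fun τ => (φ (Fin.cons t τ) * ∏ j, (1 - (x t)⁻¹ * (x (τ j))⁻¹)) *
          mon x (fun j => (m:ℤ) - (d+1:ℕ) - (j:ℕ)) τ)) :
    Lf c (a+1) (fun τ => φ τ * Kf x (a+1) τ * (x (τ 0) ^ ((m:ℤ) - d) * Pf x a m (d+1) (Fin.tail τ)))
     = Lf c (a+1) (fun τ => φ τ * mon x (fun j => (m:ℤ) - d - (j:ℕ)) τ)
       - if a % 2 = 0 then 0 else Lf c (a+1) (fun τ => φ τ * mon x (fun j => (m:ℤ) - d - 1 - (j:ℕ)) τ) := by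
  rw [← Lf_step c x hx hφ, Lf_succ, Lf_succ]
  refine Finset.sum_congr rfl fun t _ => ?_
  congr 1
  have := congrArg (fun z => x t ^ ((m:ℤ)-d) * z) (ih t)
  simp only [← Lf_mul] at this
  convert this using 2
  · funext τ
    rw [Kf_succ]
    simp only [Fin.cons_zero, Fin.cons_succ, Fin.tail_cons]; ring
  · funext τ
    unfold mon
    rw [Fin.prod_univ_succ]
    simp only [Fin.cons_zero, Fin.cons_succ]
    have : ∀ j : Fin a, (m:ℤ) - d - ((j.succ : ℕ):ℤ) = (m:ℤ) - (d+1:ℕ) - (j:ℕ) := by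
      intro j; simp; ring
    simp only [this]
    simp; ring

theorem Lf_main (hx : ∀ t, x t ≠ 0) : ∀ (a m d : ℕ) (φ : (Fin a → ι) → ℝ), AntiF φ →
    (∀ s : ℕ, s + 2 ≤ a → VanF c x φ (-(d:ℤ) - a - s)) →
    Lf c a (fun τ => φ τ * Kf x a τ * Pf x a m d τ) = Lf c a (fun τ => φ τ * mon x (fun j => (m:ℤ) - d - (j:ℕ)) τ) := by
  intro a
  induction a with
  | zero => intro m d φ _ _; simp [Lf, Kf, Pf, mon]
  | succ a ih =>
    intro m d φ hφ hV
    have key : ∀ i : ℕ, _ := fun i => Lf_peel c x hx hφ i d (fun t => ih i (d+1) _ (anti_cons x hφ t) (fun s hs => by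
      apply van_cons c x hx
      · have := hV s (by omega)
        convert this using 1; push_cast; ring
      · have := hV (s+1) (by omega)
        convert this using 1; push_cast; ring))
    simp only [Pf]
    split_ifs with ha
    · rw [key]; simp [ha]
    · simp only [Finset.mul_sum]
      rw [Lf_sum]
      simp only [key, if_neg ha]
      have hz : Lf c (a+1) (fun τ => φ τ * mon x (fun j => (0:ℤ) - d - 1 - (j:ℕ)) τ) = 0 := by
        apply Lf_van c x (hV 0 (by omega)) _ (Fin.last a)
        simp; ring
      induction m with
      | zero => simp [hz] at *; exact hz
      | succ m ihm =>
        rw [Finset.sum_range_succ, ihm]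
        push_cast
        have : (m:ℤ) + 1 - d - 1 = m - d := by ring
        rw [this]; ring

/-- moments -/
noncomputable def Hm (r : ℤ) : ℝ := ∑ t, c t * x t ^ r

lemma det_sum {a : ℕ} (g : Fin a → ι → Fin a → ℝ) :
    (Matrix.of (fun j i => ∑ t, g j t i)).det = ∑ τ : Fin a → ι, (Matrix.of (fun j i => g j (τ j) i)).det := by
  classical
  have := (Matrix.detRowAlternating (n := Fin a) (R := ℝ)).toMultilinearMap.map_sum (fun j t => g j t)
  refine Eq.trans ?_ this
  change _ = Matrix.det (fun j => ∑ t, g j t)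
  congr 1
  ext j i
  simp [Finset.sum_apply]

lemma Lf_det {a : ℕ} (r : Fin a → ℤ) (u : ι → ℝ) :
    (Matrix.of (fun j i : Fin a => ∑ t, c t * x t ^ (r j) * u t ^ (i:ℕ))).det
     = Lf c a (fun τ => (Matrix.vandermonde (u ∘ τ)).det * mon x r τ) := by
  rw [det_sum (fun j t i => c t * x t ^ (r j) * u t ^ (i:ℕ))]
  unfold Lf
  refine Finset.sum_congr rfl fun τ _ => ?_
  have := Matrix.det_mul_column (fun j => c (τ j) * x (τ j) ^ r j) (Matrix.vandermonde (u ∘ τ))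
  simp only [Matrix.vandermonde_apply, Function.comp] at this
  rw [this, Finset.prod_mul_distrib]
  unfold mon
  ring

lemma anti_vand (a : ℕ) : AntiF (fun τ : Fin a → ι => (Matrix.vandermonde (x ∘ τ)).det) := by
  intro σ τ
  have := Matrix.det_permute σ (Matrix.vandermonde (x ∘ τ))
  exact this

lemma van_vand (a : ℕ) (r : ℤ) (hx : ∀ t, x t ≠ 0) (h : ∀ s : ℕ, s < a → Hm c x (r + s) = 0) :
    VanF c x (fun τ : Fin a → ι => (Matrix.vandermonde (x ∘ τ)).det) r := by
  classical
  intro j τ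
  have e : ∀ t, Matrix.vandermonde (x ∘ Function.update τ j t)
     = (Matrix.vandermonde (x ∘ τ)).updateRow j (fun i => x t ^ (i:ℕ)) := by
    intro t
    ext k i
    by_cases hk : k = j
    · subst hk; simp [Matrix.vandermonde_apply]
    · simp [Matrix.vandermonde_apply, Matrix.updateRow_ne hk, Function.update_of_ne hk]
  simp only [e]
  have : ∀ t, c t * x t ^ r * ((Matrix.vandermonde (x ∘ τ)).updateRow j (fun i => x t ^ (i:ℕ))).det
     = ((Matrix.vandermonde (x ∘ τ)).updateRow j ((c t * x t ^ r) • (fun i : Fin a => x t ^ (i:ℕ)))).det := by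
    intro t; rw [Matrix.det_updateRow_smul]
  simp only [this]
  have h3 := map_sum ((Matrix.detRowAlternating (n := Fin a) (R := ℝ)).toMultilinearMap.toLinearMap (Matrix.vandermonde (x ∘ τ)) j)
    (fun t => (c t * x t ^ r) • (fun i : Fin a => x t ^ (i:ℕ))) Finset.univ
  change _ = 0
  refine h3.symm.trans ?_
  have : (∑ t, (c t * x t ^ r) • (fun i : Fin a => x t ^ (i:ℕ))) = 0 := by
    funext i
    rw [Finset.sum_apply]
    simp only [Pi.smul_apply, smul_eq_mul, Pi.zero_apply]
    rw [← h i i.2]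
    unfold Hm
    refine Finset.sum_congr rfl fun t _ => ?_
    rw [zpow_add₀ (hx t), zpow_natCast, mul_assoc]
  rw [this, map_zero]

/-- Toeplitz determinants. -/
noncomputable def Tz (H : ℤ → ℝ) (a : ℕ) (m : ℤ) : ℝ :=
  (Matrix.of (fun j i : Fin a => H (m - (j:ℕ) + (i:ℕ)))).det

lemma vand_K (a : ℕ) (hx : ∀ t, x t ≠ 0) (τ : Fin a → ι) :
    (Matrix.vandermonde ((fun t => x t + (x t)⁻¹) ∘ τ)).det = (Matrix.vandermonde (x ∘ τ)).det * Kf x a τ := by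
  rw [Matrix.det_vandermonde, Matrix.det_vandermonde, Kf, ← Finset.prod_mul_distrib]
  refine Finset.prod_congr rfl fun i _ => ?_
  rw [← Finset.prod_mul_distrib]
  refine Finset.prod_congr rfl fun j _ => ?_
  have := hx (τ i); have := hx (τ j)
  simp only [Function.comp]
  field_simp
  ring

/-- sum of the folded determinants is the Toeplitz determinant -/
theorem sum_fold (hx : ∀ t, x t ≠ 0) (a m : ℕ) {κ : Type} (s : Finset κ) (lam : κ → Fin a → ℕ)
    (hP : ∀ τ, ∑ k ∈ s, mon x (fun j => (lam k j : ℤ) - (j:ℕ)) τ = Pf x a m 0 τ)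
    (hH : ∀ r : ℤ, -(2 * (a:ℤ)) + 2 ≤ r → r ≤ -1 → Hm c x r = 0) :
    ∑ k ∈ s, (Matrix.of (fun j i : Fin a => ∑ t, c t * x t ^ ((lam k j : ℤ) - (j:ℕ)) * (x t + (x t)⁻¹) ^ (i:ℕ))).det
     = Tz (Hm c x) a m := by
  have h1 : ∀ k, (Matrix.of (fun j i : Fin a => ∑ t, c t * x t ^ ((lam k j : ℤ) - (j:ℕ)) * (x t + (x t)⁻¹) ^ (i:ℕ))).det
     = _ := fun k => Lf_det c x (fun j => (lam k j : ℤ) - (j:ℕ)) (fun t => x t + (x t)⁻¹)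
  simp only [h1, vand_K x a hx]
  rw [← Lf_sum]
  simp only [← Finset.mul_sum, hP]
  rw [Lf_main c x hx a m 0 _ (anti_vand x a)]
  · rw [← Lf_det]
    unfold Tz Hm
    congr 1
    ext j i
    simp only [Matrix.of_apply]
    refine Finset.sum_congr rfl fun t _ => ?_
    rw [zpow_add₀ (hx t), zpow_natCast]; simp [mul_assoc]
  · intro s hs
    apply van_vand c x a _ hx
    intro s' hs'
    apply hH <;> push_cast <;> omega

end abstractPart2
section combPart

/-- prepend an entry to a sequence -/
def consN (y : ℕ) (k : ℕ → ℕ) : ℕ → ℕ := fun c => Nat.casesOn c y k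

@[simp] lemma consN_zero (y : ℕ) (k : ℕ → ℕ) : consN y k 0 = y := rfl
@[simp] lemma consN_succ (y : ℕ) (k : ℕ → ℕ) (c : ℕ) : consN y k (c+1) = k c := rfl

lemma consN_inj (y : ℕ) : Function.Injective (consN y) := by
  intro k k' e
  funext c
  have := congrFun e (c+1)
  simpa using this

open Classical in
/-- index set of the sums -/
noncomputable def KS : ℕ → ℕ → Finset (ℕ → ℕ)
  | 0, m => {fun c => if c = 0 then m else 0}
  | (a+1), m => if a % 2 = 0 then (KS a m).image (consN 0)
      else (Finset.range (m+1)).biUnion (fun i => (KS a i).image (consN (m - i)))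

lemma mem_KS (a : ℕ) : ∀ (m : ℕ) (k : ℕ → ℕ), k ∈ KS a m ↔
    (∀ c, k c ≠ 0 → c ≤ a ∧ c % 2 = a % 2) ∧ ∑ c ∈ Finset.range (a+1), k c = m := by
  classical
  induction a with
  | zero =>
    intro m k
    simp only [KS, Finset.mem_singleton]
    constructor
    · rintro rfl
      simp
    · rintro ⟨h1, h2⟩
      funext c
      by_cases hc : c = 0
      · subst hc; simpa using h2
      · simp only [hc, if_false]
        by_contra h
        have := (h1 c h).1
        omega
  | succ a ih =>
    intro m k
    have hshift : (∀ c, k c ≠ 0 → c ≤ a+1 ∧ c % 2 = (a+1) % 2) ↔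
        ((a % 2 = 0 → k 0 = 0) ∧ ∀ c, k (c+1) ≠ 0 → c ≤ a ∧ c % 2 = a % 2) := by
      constructor
      · intro h
        refine ⟨fun ha => ?_, fun c hc => ?_⟩
        · by_contra hk
          have := (h 0 hk).2; omega
        · have := h _ hc; omega
      · rintro ⟨h0, h⟩ c hc
        rcases c with _ | c
        · refine ⟨by omega, ?_⟩
          by_contra hh
          exact hc (h0 (by omega))
        · have := h c hc; omega
    have hk : k = consN (k 0) (fun c => k (c+1)) := by
      funext c; cases c <;> rfl
    rw [hshift, Finset.sum_range_succ']
    simp only [KS]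
    split_ifs with ha
    · simp only [Finset.mem_image, ih]
      constructor
      · rintro ⟨k', ⟨h1, h2⟩, rfl⟩
        simp only [consN_succ, consN_zero]
        exact ⟨⟨fun _ => trivial, h1⟩, by simpa using h2⟩
      · rintro ⟨⟨h1, h2⟩, h3⟩
        have h1 := h1 ha
        refine ⟨fun c => k (c+1), ⟨h2, by beta_reduce; omega⟩, ?_⟩
        rw [hk, h1]; rfl
    · simp only [Finset.mem_biUnion, Finset.mem_image, ih, Finset.mem_range]
      constructor
      · rintro ⟨i, hi, k', ⟨h1, h2⟩, rfl⟩
        simp only [consN_succ, consN_zero]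
        exact ⟨⟨fun h => absurd h ha, h1⟩, by omega⟩
      · rintro ⟨⟨h1, h2⟩, h3⟩
        refine ⟨m - k 0, by omega, fun c => k (c+1), ⟨h2, by beta_reduce; omega⟩, ?_⟩
        have : m - (m - k 0) = k 0 := by omega
        rw [this]
        exact hk.symm

lemma sum_KS_even {M : Type} [AddCommMonoid M] (a m : ℕ) (ha : a % 2 = 0) (f : (ℕ → ℕ) → M) :
    ∑ k ∈ KS (a+1) m, f k = ∑ k ∈ KS a m, f (consN 0 k) := by
  classical
  simp only [KS, if_pos ha]
  rw [Finset.sum_image (fun _ _ _ _ e => consN_inj _ e)]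

lemma sum_KS_odd {M : Type} [AddCommMonoid M] (a m : ℕ) (ha : ¬ a % 2 = 0) (f : (ℕ → ℕ) → M) :
    ∑ k ∈ KS (a+1) m, f k = ∑ i ∈ Finset.range (m+1), ∑ k ∈ KS a i, f (consN (m - i) k) := by
  classical
  simp only [KS, if_neg ha]
  rw [Finset.sum_biUnion]
  · refine Finset.sum_congr rfl fun i _ => ?_
    rw [Finset.sum_image (fun _ _ _ _ e => consN_inj _ e)]
  · intro i hi j hj hij
    simp only [Function.onFun]
    rw [Finset.disjoint_left]
    intro k hk hk'
    simp only [Finset.mem_image] at hk hk'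
    obtain ⟨k1, _, rfl⟩ := hk
    obtain ⟨k2, _, e⟩ := hk'
    have := congrFun e 0
    simp at this hi hj
    omega

/-- the partition attached to `k` -/
def lamk (a : ℕ) (k : ℕ → ℕ) (i : ℕ) : ℕ := ∑ c ∈ Finset.range (a+1), if i < c then k c else 0

lemma lamk_zero (a y : ℕ) (k : ℕ → ℕ) : lamk (a+1) (consN y k) 0 = ∑ c ∈ Finset.range (a+1), k c := by
  unfold lamk
  rw [Finset.sum_range_succ']
  simp

lemma lamk_succ (a y i : ℕ) (k : ℕ → ℕ) : lamk (a+1) (consN y k) (i+1) = lamk a k i := by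
  unfold lamk
  rw [Finset.sum_range_succ']
  simp

lemma lamk_ge (a i : ℕ) (k : ℕ → ℕ) (h : a ≤ i) : lamk a k i = 0 := by
  unfold lamk
  apply Finset.sum_eq_zero
  intro c hc
  simp at hc
  rw [if_neg (by omega)]

theorem sum_KS_mon {ι : Type} (x : ι → ℝ) (a : ℕ) : ∀ (m d : ℕ) (τ : Fin a → ι),
    ∑ k ∈ KS a m, mon x (fun j => (lamk a k j : ℤ) - (j:ℕ) - d) τ = Pf x a m d τ := by
  induction a with
  | zero => intro m d τ; simp [KS, mon, Pf]
  | succ a ih =>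
    intro m d τ
    have key : ∀ (y i : ℕ), ∀ k ∈ KS a i, mon x (fun j : Fin (a+1) => (lamk (a+1) (consN y k) j : ℤ) - (j:ℕ) - d) τ
       = x (τ 0) ^ ((i:ℤ) - d) * mon x (fun j => (lamk a k j : ℤ) - (j:ℕ) - (d+1:ℕ)) (Fin.tail τ) := by
      intro y i k hk
      have hk := ((mem_KS a i k).1 hk).2
      unfold mon
      rw [Fin.prod_univ_succ]
      simp only [Fin.val_zero, Fin.val_succ, lamk_zero, lamk_succ, hk]
      congr 1
      · refine Finset.prod_congr rfl fun j _ => ?_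
        simp only [Fin.tail]
        congr 1
        push_cast; ring
    simp only [Pf]
    split_ifs with ha
    · rw [sum_KS_even a m ha, ← ih, Finset.mul_sum]
      exact Finset.sum_congr rfl fun k hk => key 0 m k hk
    · rw [sum_KS_odd a m ha]
      refine Finset.sum_congr rfl fun i _ => ?_
      rw [← ih, Finset.mul_sum]
      exact Finset.sum_congr rfl fun k hk => key _ i k hk

end combPart
section chiPart

lemma supp_sum {a : ℕ} {k : ℕ → ℕ} (hk : ∀ c, k c ≠ 0 → c ≤ a ∧ c % 2 = a % 2) :
    ∑ᶠ c ∈ {c : ℕ | c ≠ a}, k c = ∑ c ∈ Finset.range a, k c := by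
  apply finsum_mem_eq_sum_of_inter_support_eq
  ext c
  simp only [Set.mem_inter_iff, Set.mem_ofPred_eq, Function.mem_support, Finset.coe_range, Set.mem_Iio]
  constructor
  · rintro ⟨h1, h2⟩
    have := (hk c h2).1
    exact ⟨by omega, h2⟩
  · rintro ⟨h1, h2⟩
    exact ⟨by omega, h2⟩

lemma supp_sum2 {a : ℕ} {k : ℕ → ℕ} (hk : ∀ c, k c ≠ 0 → c ≤ a ∧ c % 2 = a % 2) :
    ∑ᶠ (c : ℕ) (_ : c ≠ a), k c = ∑ c ∈ Finset.range a, k c := by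
  have := supp_sum hk
  simpa only [Set.mem_ofPred_eq] using this

lemma supp_wt {n a : ℕ} {k : ℕ → ℕ} (hk : ∀ c, k c ≠ 0 → c ≤ a ∧ c % 2 = a % 2) (i : Fin n) :
    ∑ᶠ c : ℕ, (k c : ℚ) * fwB n c i = ∑ c ∈ Finset.range (a+1), (k c : ℚ) * fwB n c i := by
  apply finsum_eq_sum_of_support_subset
  intro c hc
  simp only [Function.mem_support] at hc
  have : k c ≠ 0 := by
    intro h; apply hc; simp [h]
  have := (hk c this).1
  simp; omega

lemma fwB_lt {n c : ℕ} (hc : c < n) (i : Fin n) : fwB n c i = if (i:ℕ) < c then 1 else 0 := by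
  unfold fwB
  split_ifs with h1 h2 h3 h3 <;> first | rfl | omega | skip
  all_goals simp_all

theorem chiB_lt {n a : ℕ} (ha : a < n) (m : ℕ) (h : Fin n → ℝ) :
    chiB n a m h = ∑ k ∈ KS a m, chB n (fun i => (lamk a k i : ℚ)) h := by
  unfold chiB
  have hset : {k : ℕ → ℕ | (∀ c, k c ≠ 0 → c ≤ a ∧ c % 2 = a % 2) ∧
      tpap n a * (∑ᶠ c ∈ {c : ℕ | c ≠ a}, k c) + k a = m} = ↑(KS a m) := by
    ext k
    simp only [Set.mem_ofPred_eq, Finset.mem_coe, mem_KS]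
    refine and_congr_right fun hk => ?_
    rw [supp_sum2 hk, Finset.sum_range_succ, tpap, if_neg (by omega), one_mul]
  rw [hset, finsum_mem_coe_finset]
  refine Finset.sum_congr rfl fun k hk => ?_
  have hk := ((mem_KS a m k).1 hk).1
  congr 1
  funext i
  rw [supp_wt hk, lamk, Nat.cast_sum]
  refine Finset.sum_congr rfl fun c hc => ?_
  simp at hc
  rw [fwB_lt (by omega)]
  split_ifs <;> simp

/-- spin version of `k` -/
def upk (n ε : ℕ) (k : ℕ → ℕ) : ℕ → ℕ := Function.update k n (2 * k n + ε)

lemma upk_inj (n ε : ℕ) : Function.Injective (upk n ε) := by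
  intro k k' e
  funext c
  have := congrFun e c
  by_cases hc : c = n
  · subst hc; simp [upk] at this; exact this
  · simpa [upk, hc] using this

theorem chiB_n {n : ℕ} (m ε : ℕ) (hε : ε < 2) (h : Fin n → ℝ) :
    chiB n n (2*m+ε) h = ∑ k ∈ KS n m, chB n (fun i => (lamk n k i : ℚ) + (ε:ℚ)/2) h := by
  classical
  unfold chiB
  have hset : {k : ℕ → ℕ | (∀ c, k c ≠ 0 → c ≤ n ∧ c % 2 = n % 2) ∧
      tpap n n * (∑ᶠ c ∈ {c : ℕ | c ≠ n}, k c) + k n = 2*m+ε} = ↑((KS n m).image (upk n ε)) := by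
    ext k
    simp only [Set.mem_ofPred_eq, Finset.mem_coe, Finset.mem_image, mem_KS]
    constructor
    · rintro ⟨hk, h2⟩
      rw [supp_sum2 hk, tpap, if_pos rfl] at h2
      refine ⟨Function.update k n ((k n - ε)/2), ⟨?_, ?_⟩, ?_⟩
      · intro c hc
        by_cases h : c = n
        · subst h; simp
        · rw [Function.update_of_ne h] at hc; exact hk c hc
      · rw [Finset.sum_range_succ]
        simp only [Function.update_self]
        have : ∑ c ∈ Finset.range n, Function.update k n ((k n - ε)/2) c = ∑ c ∈ Finset.range n, k c := by
          refine Finset.sum_congr rfl fun c hc => ?_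
          simp at hc
          rw [Function.update_of_ne (by omega)]
        omega
      · unfold upk
        simp only [Function.update_self, Function.update_idem]
        funext c
        by_cases h : c = n
        · subst h; simp; omega
        · rw [Function.update_of_ne h]
    · rintro ⟨k', ⟨hk, h2⟩, rfl⟩
      have hk' : ∀ c, upk n ε k' c ≠ 0 → c ≤ n ∧ c % 2 = n % 2 := by
        intro c hc
        by_cases h : c = n
        · subst h; simp
        · rw [upk, Function.update_of_ne h] at hc; exact hk c hc
      refine ⟨hk', ?_⟩
      rw [supp_sum2 hk', tpap, if_pos rfl]
      have : ∑ c ∈ Finset.range n, upk n ε k' c = ∑ c ∈ Finset.range n, k' c := by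
          refine Finset.sum_congr rfl fun c hc => ?_
          simp at hc
          rw [upk, Function.update_of_ne (by omega)]
      rw [this]
      rw [Finset.sum_range_succ] at h2
      simp [upk]; omega
  rw [hset, finsum_mem_coe_finset, Finset.sum_image (fun _ _ _ _ e => upk_inj _ _ e)]
  refine Finset.sum_congr rfl fun k hk => ?_
  have hk := ((mem_KS n m k).1 hk).1
  have hk' : ∀ c, upk n ε k c ≠ 0 → c ≤ n ∧ c % 2 = n % 2 := by
        intro c hc
        by_cases h : c = n
        · subst h; simp
        · rw [upk, Function.update_of_ne h] at hc; exact hk c hc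
  congr 1
  funext i
  rw [supp_wt hk', lamk, Nat.cast_sum, Finset.sum_range_succ, Finset.sum_range_succ]
  have e1 : ∑ c ∈ Finset.range n, (upk n ε k c : ℚ) * fwB n c i
     = ∑ c ∈ Finset.range n, ((if (i:ℕ) < c then k c else 0 : ℕ) : ℚ) := by
    refine Finset.sum_congr rfl fun c hc => ?_
    simp at hc
    rw [fwB_lt (by omega), upk, Function.update_of_ne (by omega)]
    split_ifs <;> simp
  have e2 : fwB n n i = 1/2 := by
    have := i.2
    unfold fwB
    rw [if_neg (by omega), if_pos rfl]
  rw [e1, e2, if_pos i.2]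
  simp [upk]; ring

end chiPart
section foldPart
set_option linter.unusedSectionVars false
variable {ι : Type} [Fintype ι] (c x : ι → ℝ)

/-- folded moment matrix -/
noncomputable def FM (b : ℕ) (lam : ℕ → ℕ) : Matrix (Fin b) (Fin b) ℝ :=
  Matrix.of (fun j i => ∑ t, c t * x t ^ ((lam j : ℤ) - (j:ℕ)) * (x t + (x t)⁻¹) ^ (i:ℕ))

lemma fold_mom (hx : ∀ t, x t ≠ 0) (i : ℕ) : ∀ r : ℤ, (∀ s : ℤ, r - i ≤ s → s < r + i → Hm c x s = 0) →
    ∑ t, c t * x t ^ r * (x t + (x t)⁻¹) ^ i = Hm c x (r + i) := by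
  induction i with
  | zero => intro r _; simp [Hm]
  | succ i ih =>
    intro r hr
    have e : ∑ t, c t * x t ^ r * (x t + (x t)⁻¹) ^ (i+1)
       = ∑ t, c t * x t ^ (r+1) * (x t + (x t)⁻¹) ^ i + ∑ t, c t * x t ^ (r-1) * (x t + (x t)⁻¹) ^ i := by
      rw [← Finset.sum_add_distrib]
      refine Finset.sum_congr rfl fun t _ => ?_
      rw [zpow_add_one₀ (hx t), zpow_sub_one₀ (hx t)]; ring
    rw [e, ih, ih]
    · rw [hr (r - 1 + i)]
      · push_cast; rw [add_zero]; congr 1; ring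
      · push_cast; omega
      · push_cast; omega
    · intro s h1 h2; apply hr <;> push_cast <;> omega
    · intro s h1 h2; apply hr <;> push_cast <;> omega

lemma FM_step (hx : ∀ t, x t ≠ 0) (b : ℕ) (lam : ℕ → ℕ) (hl : lam b = 0) (h0 : Hm c x 0 = 1)
    (hH : ∀ r : ℤ, -(2 * (b:ℤ)) ≤ r → r ≤ -1 → Hm c x r = 0) :
    (FM c x (b+1) lam).det = (FM c x b lam).det := by
  rw [Matrix.det_succ_row _ (Fin.last b), Fin.sum_univ_castSucc]
  have hz : ∀ i : Fin b, FM c x (b+1) lam (Fin.last b) i.castSucc = 0 := by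
    intro i
    have := i.2
    simp only [FM, Matrix.of_apply, Fin.val_last, Fin.val_castSucc, hl]
    rw [fold_mom c x hx]
    · apply hH <;> push_cast <;> omega
    · intro s h1 h2; apply hH <;> push_cast at * <;> omega
  have h1 : FM c x (b+1) lam (Fin.last b) (Fin.last b) = 1 := by
    simp only [FM, Matrix.of_apply, Fin.val_last, hl]
    rw [fold_mom c x hx]
    · rw [← h0]; congr 1; push_cast; ring
    · intro s h1 h2; apply hH <;> push_cast at * <;> omega
  simp only [hz, h1]
  have : (FM c x (b+1) lam).submatrix (Fin.last b).succAbove (Fin.last b).succAbove = FM c x b lam := by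
    ext i j
    simp [FM]
  rw [this]
  simp [← two_mul, pow_mul]

lemma FM_tail (hx : ∀ t, x t ≠ 0) (N : ℕ) (lam : ℕ → ℕ) (h0 : Hm c x 0 = 1)
    (hH : ∀ r : ℤ, -(2 * (N:ℤ)) + 2 ≤ r → r ≤ -1 → Hm c x r = 0) (a : ℕ) (ha : a ≤ N)
    (hl : ∀ j, a ≤ j → lam j = 0) : (FM c x N lam).det = (FM c x a lam).det := by
  induction N with
  | zero => obtain rfl : a = 0 := by omega
            rfl
  | succ N ih =>
    rcases Nat.lt_or_ge N a with h | h
    · obtain rfl : a = N + 1 := by omega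
      rfl
    · rw [FM_step c x hx N lam (hl N h) h0, ih _ h]
      · intro r h1 h2; apply hH <;> push_cast at * <;> omega
      · intro r h1 h2; apply hH <;> push_cast at * <;> omega

end foldPart

section charPart

noncomputable def vv (p t : ℝ) : ℝ := Real.exp (p * t) - Real.exp (-(p * t))

lemma anum_det (n : ℕ) (μ : Fin n → ℚ) (h : Fin n → ℝ) :
    anum n μ h = (Matrix.of (fun k i : Fin n => vv (μ i) (h k))).det := by
  classical
  unfold anum
  rw [Matrix.det_apply']
  refine Finset.sum_congr rfl fun σ _ => ?_
  have e : ∀ i, Matrix.of (fun k i : Fin n => vv (μ i) (h k)) (σ i) i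
     = ∑ b : Bool, (if b then (1:ℝ) else -1) * Real.exp ((μ i : ℝ) * (if b then (1:ℝ) else -1) * h (σ i)) := by
    intro i
    simp [vv]; ring
  simp only [e]
  rw [Finset.prod_univ_sum, Finset.mul_sum, Fintype.piFinset_univ]
  refine Finset.sum_congr rfl fun ε _ => ?_
  rw [Finset.prod_mul_distrib, Real.exp_sum, mul_assoc]

noncomputable def LL {n : ℕ} (d h : Fin n → ℝ) (p : ℝ) : ℝ := ∑ k, d k * vv p (h k)

noncomputable def xf {n : ℕ} (h : Fin n → ℝ) (t : Fin n × Bool) : ℝ :=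
  if t.2 then Real.exp (h t.1) else Real.exp (-(h t.1))

noncomputable def cf {n : ℕ} (s : ℝ) (d h : Fin n → ℝ) (t : Fin n × Bool) : ℝ :=
  if t.2 then d t.1 * Real.exp (s * h t.1) else -(d t.1 * Real.exp (-(s * h t.1)))

noncomputable def X2 (t : ℝ) : ℝ := Real.exp t + Real.exp (-t)

lemma xf_ne {n : ℕ} (h : Fin n → ℝ) (t : Fin n × Bool) : xf h t ≠ 0 := by
  unfold xf; split_ifs <;> exact (Real.exp_pos _).ne'

lemma exp_zp (t : ℝ) (r : ℤ) : Real.exp t ^ r = Real.exp (r * t) := by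
  rw [← Real.rpow_intCast, ← Real.exp_mul, mul_comm]

lemma mom_eq {n : ℕ} (s : ℝ) (d h : Fin n → ℝ) (r : ℤ) (i : ℕ) :
    ∑ t, cf s d h t * xf h t ^ r * (xf h t + (xf h t)⁻¹) ^ i
      = ∑ k, vv (r + s) (h k) * (d k * X2 (h k) ^ i) := by
  rw [Fintype.sum_prod_type]
  refine Finset.sum_congr rfl fun k _ => ?_
  simp only [Fintype.sum_bool, cf, xf, if_true, Bool.false_eq_true, if_false, X2, vv,
    ← Real.exp_neg, neg_neg]
  have e1 : Real.exp ((r + s) * h k) = Real.exp (s * h k) * Real.exp (r * h k) := by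
    rw [← Real.exp_add]; congr 1; ring
  have e2 : Real.exp (-((r + s) * h k)) = Real.exp (-(s * h k)) * Real.exp (r * -h k) := by
    rw [← Real.exp_add]; congr 1; ring
  rw [e1, e2, add_comm (Real.exp (- h k)), exp_zp, exp_zp]
  ring

lemma Hm_LL {n : ℕ} (s : ℝ) (d h : Fin n → ℝ) (r : ℤ) :
    Hm (cf s d h) (xf h) r = LL d h (r + s) := by
  have := mom_eq s d h r 0
  simp only [pow_zero, mul_one] at this
  rw [Hm, this, LL]
  exact Finset.sum_congr rfl fun k _ => mul_comm _ _

noncomputable def QQ {n : ℕ} (d h : Fin n → ℝ) : ℝ :=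
  (Matrix.of (fun k i : Fin n => d k * X2 (h k) ^ (i:ℕ))).det

noncomputable def PP {n : ℕ} (s : ℝ) (h : Fin n → ℝ) (lam : ℕ → ℕ) : ℝ :=
  (Matrix.of (fun k i : Fin n => vv ((lam i : ℝ) - (i:ℕ) + s) (h k))).det

lemma PP_QQ {n : ℕ} (s : ℝ) (d h : Fin n → ℝ) (lam : ℕ → ℕ) :
    PP s h lam * QQ d h = (FM (cf s d h) (xf h) n lam).det := by
  rw [PP, QQ, ← Matrix.det_transpose, ← Matrix.det_mul]
  congr 1
  ext j i
  rw [Matrix.mul_apply]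
  simp only [FM, Matrix.of_apply, Matrix.transpose_apply, mom_eq]
  push_cast
  rfl

theorem PP_sum {n : ℕ} (s : ℝ) (d h : Fin n → ℝ) (h0 : LL d h s = 1)
    (hz : ∀ r : ℤ, -(2 * (n:ℤ)) + 2 ≤ r → r ≤ -1 → LL d h (r + s) = 0) (a m : ℕ) (ha : a ≤ n) :
    ∑ k ∈ KS a m, PP s h (lamk a k) * QQ d h = Tz (fun r => LL d h (r + s)) a m := by
  have h0' : Hm (cf s d h) (xf h) 0 = 1 := by rw [Hm_LL]; simpa using h0
  have hz' : ∀ r : ℤ, -(2 * (n:ℤ)) + 2 ≤ r → r ≤ -1 → Hm (cf s d h) (xf h) r = 0 := by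
    intro r h1 h2; rw [Hm_LL]; exact hz r h1 h2
  have e : ∀ k ∈ KS a m, PP s h (lamk a k) * QQ d h = (FM (cf s d h) (xf h) a (lamk a k)).det := by
    intro k _
    rw [PP_QQ, FM_tail _ _ (xf_ne h) n _ h0' hz' a ha (fun j hj => lamk_ge a j k hj)]
  rw [Finset.sum_congr rfl e]
  have := sum_fold (cf s d h) (xf h) (xf_ne h) a m (KS a m) (fun k j => lamk a k j) (by
    intro τ
    have := sum_KS_mon (xf h) a m 0 τ
    simpa using this) (by
    intro r h1 h2; apply hz' <;> omega)
  rw [show (fun r : ℤ => LL d h (r + s)) = Hm (cf s d h) (xf h) from funext fun r => (Hm_LL s d h r).symm]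
  exact this

theorem PP_zero {n : ℕ} (s : ℝ) (d h : Fin n → ℝ) (h0 : LL d h s = 1)
    (hz : ∀ r : ℤ, -(2 * (n:ℤ)) + 2 ≤ r → r ≤ -1 → LL d h (r + s) = 0) :
    PP s h (fun _ => 0) * QQ d h = 1 := by
  have h0' : Hm (cf s d h) (xf h) 0 = 1 := by rw [Hm_LL]; simpa using h0
  have hz' : ∀ r : ℤ, -(2 * (n:ℤ)) + 2 ≤ r → r ≤ -1 → Hm (cf s d h) (xf h) r = 0 := by
    intro r h1 h2; rw [Hm_LL]; exact hz r h1 h2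
  rw [PP_QQ, FM_tail _ _ (xf_ne h) n _ h0' hz' 0 (Nat.zero_le _) (fun _ _ => rfl)]
  simp

lemma vv_neg (p t : ℝ) : vv (-p) t = - vv p t := by
  simp [vv]

lemma LL_neg {n : ℕ} (d h : Fin n → ℝ) (p : ℝ) : LL d h (-p) = - LL d h p := by
  simp [LL, vv_neg]

/-- `2 cosh (t/2)` -/
noncomputable def th (t : ℝ) : ℝ := Real.exp (t/2) + Real.exp (-(t/2))

lemma th_pos (t : ℝ) : 0 < th t := by unfold th; positivity

lemma th_vv (p t : ℝ) : th t * vv (p - 1/2) t = vv p t + vv (p - 1) t := by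
  unfold th vv
  simp only [add_mul, mul_sub, ← Real.exp_add]
  ring_nf

/-- the dual coefficients -/
lemma exists_d {n : ℕ} (hn : 1 ≤ n) (h : Fin n → ℝ) (hden : anum n (rhoB n) h ≠ 0) :
    ∃ d : Fin n → ℝ, LL d h ((n:ℝ) - 1/2) = 1 ∧
      ∀ r : ℤ, -(2 * (n:ℤ)) + 2 ≤ r → r ≤ -1 → LL d h (r + ((n:ℝ) - 1/2)) = 0 := by
  classical
  rw [anum_det] at hden
  set M := Matrix.of (fun k i : Fin n => vv (rhoB n i : ℚ) (h k)) with hM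
  have hu : IsUnit M.det := isUnit_iff_ne_zero.2 hden
  set i0 : Fin n := ⟨0, hn⟩ with hi0
  refine ⟨Matrix.vecMul (Pi.single i0 1) M⁻¹, ?_⟩
  set d := Matrix.vecMul (Pi.single i0 1) M⁻¹ with hd
  have hdm : Matrix.vecMul d M = Pi.single i0 1 := by
    rw [hd, Matrix.vecMul_vecMul, Matrix.nonsing_inv_mul _ hu, Matrix.vecMul_one]
  have hj : ∀ j : Fin n, LL d h ((n:ℝ) - (j:ℕ) - 1/2) = (Pi.single i0 1 : Fin n → ℝ) j := by
    intro j
    rw [← hdm]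
    simp only [Matrix.vecMul, dotProduct, LL, hM, Matrix.of_apply, rhoB]
    push_cast
    rfl
  constructor
  · have := hj i0
    simpa [hi0] using this
  · have hneg : ∀ r : ℕ, 1 ≤ r → r < n → LL d h (-(r:ℝ) + ((n:ℝ) - 1/2)) = 0 := by
      intro r h1 h2
      have := hj ⟨r, h2⟩
      rw [Pi.single_eq_of_ne (by simp [hi0, Fin.ext_iff]; omega)] at this
      rw [← this]; congr 1; simp; ring
    intro r h1 h2
    obtain ⟨q, hq⟩ : ∃ q : ℕ, r = -(q:ℤ) := ⟨r.natAbs, by omega⟩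
    subst hq
    rcases lt_or_ge q n with h3 | h3
    · have := hneg q (by omega) h3
      rw [← this]; congr 1; push_cast; ring
    · have := hneg (2*n - 1 - q) (by omega) (by omega)
      have e : ((-(q:ℤ) : ℤ) : ℝ) + ((n:ℝ) - 1/2) = -(-(((2*n-1-q : ℕ)) : ℝ) + ((n:ℝ) - 1/2)) := by
        rw [Nat.cast_sub (by omega), Nat.cast_sub (by omega)]; push_cast; ring
      rw [e, LL_neg, this, neg_zero]

lemma C_d {n : ℕ} (hn : 1 ≤ n) (d h : Fin n → ℝ) (h0 : LL d h ((n:ℝ) - 1/2) = 1)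
    (hz : ∀ r : ℤ, -(2 * (n:ℤ)) + 2 ≤ r → r ≤ -1 → LL d h (r + ((n:ℝ) - 1/2)) = 0) :
    LL (fun k => d k / th (h k)) h n = 1 ∧
    ∀ r : ℤ, -(2 * (n:ℤ)) + 1 ≤ r → r ≤ -1 → LL (fun k => d k / th (h k)) h (r + (n:ℝ)) = 0 := by
  set e := (fun k => d k / th (h k)) with he
  have hrec : ∀ p, LL d h (p - 1/2) = LL e h p + LL e h (p-1) := by
    intro p
    unfold LL
    rw [← Finset.sum_add_distrib]
    refine Finset.sum_congr rfl fun k _ => ?_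
    have := (th_pos (h k)).ne'
    rw [← mul_add, ← th_vv, he]
    field_simp
  have hnat : ∀ p : ℕ, p < n → LL e h p = 0 := by
    intro p
    induction p with
    | zero => intro _; simp [LL, vv]
    | succ p ih =>
      intro hp
      have h1 := hrec ((p+1:ℕ):ℝ)
      have h2 := hz (-(n:ℤ) + p + 1) (by omega) (by omega)
      have e1 : ((-(n:ℤ) + p + 1 : ℤ):ℝ) + ((n:ℝ) - 1/2) = ((p+1:ℕ):ℝ) - 1/2 := by push_cast; ring
      rw [e1] at h2
      have e2 : ((p+1:ℕ):ℝ) - 1 = p := by push_cast; ring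
      rw [h2, e2, ih (by omega), add_zero] at h1
      exact h1.symm
  constructor
  · have h1 := hrec n
    have e2 : (n:ℝ) - 1 = (n-1:ℕ) := by rw [Nat.cast_sub hn]; simp
    rw [h0, e2, hnat (n-1) (by omega), add_zero] at h1
    exact h1.symm
  · intro r h1 h2
    rcases le_or_gt 0 (r + n) with h3 | h3
    · have := hnat (r+n).toNat (by omega)
      rw [← this]; congr 1
      have : (((r+n).toNat : ℤ) : ℝ) = ((r + n : ℤ) : ℝ) := by rw [Int.toNat_of_nonneg h3]
      push_cast at this
      rw [← this]
    · have := hnat (-(r+n)).toNat (by omega)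
      have e3 : (((-(r+n)).toNat : ℤ) : ℝ) = ((-(r + n) : ℤ) : ℝ) := by rw [Int.toNat_of_nonneg (by omega)]
      push_cast at e3
      rw [e3, LL_neg] at this
      linarith

lemma QQ_C {n : ℕ} (d h : Fin n → ℝ) :
    QQ d h = (∏ k, th (h k)) * QQ (fun k => d k / th (h k)) h := by
  unfold QQ
  have := Matrix.det_mul_column (fun k => th (h k)) (Matrix.of (fun k i : Fin n => (fun k => d k / th (h k)) k * X2 (h k) ^ (i:ℕ)))
  rw [← this]
  congr 1
  ext k i
  have := (th_pos (h k)).ne'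
  simp only [Matrix.of_apply]
  field_simp

lemma anum_PP {n : ℕ} (h : Fin n → ℝ) (lam : ℕ → ℕ) (e : ℚ) (s : ℝ) (hs : s = (n:ℝ) - 1/2 + e) :
    anum n (fun i => ((lam i : ℚ) + e) + rhoB n i) h = PP s h lam := by
  rw [anum_det, PP]
  congr 1
  ext k i
  simp only [Matrix.of_apply, rhoB]
  congr 1
  rw [hs]; push_cast; ring

lemma chB_B {n : ℕ} (d h : Fin n → ℝ) (h0 : LL d h ((n:ℝ) - 1/2) = 1)
    (hz : ∀ r : ℤ, -(2 * (n:ℤ)) + 2 ≤ r → r ≤ -1 → LL d h (r + ((n:ℝ) - 1/2)) = 0)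
    (lam : ℕ → ℕ) (e : ℚ) :
    chB n (fun i => (lam i : ℚ) + e) h = PP ((n:ℝ) - 1/2 + e) h lam * QQ d h := by
  have h1 := anum_PP h lam e ((n:ℝ) - 1/2 + e) rfl
  have h2 := anum_PP h (fun _ => 0) 0 ((n:ℝ) - 1/2) (by simp)
  have h3 := PP_zero _ d h h0 hz
  simp only [Nat.cast_zero, add_zero, zero_add] at h2
  unfold chB
  rw [h1]
  rw [show (rhoB n) = fun i => rhoB n i from rfl, h2, eq_comm, eq_div_iff (left_ne_zero_of_mul_eq_one h3)]
  linear_combination (-PP ((n:ℝ) - 1/2 + e) h lam) * h3 + 2 * PP ((n:ℝ) - 1/2 + e) h lam * h3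

theorem chi_B {n : ℕ} (d h : Fin n → ℝ) (h0 : LL d h ((n:ℝ) - 1/2) = 1)
    (hz : ∀ r : ℤ, -(2 * (n:ℤ)) + 2 ≤ r → r ≤ -1 → LL d h (r + ((n:ℝ) - 1/2)) = 0)
    (a m : ℕ) (ha : a < n) :
    chiB n a m h = Tz (fun r => LL d h (r + ((n:ℝ) - 1/2))) a m := by
  rw [chiB_lt ha, ← PP_sum _ d h h0 hz a m ha.le]
  refine Finset.sum_congr rfl fun k _ => ?_
  have := chB_B d h h0 hz (lamk a k) 0
  simpa using this

theorem chi_B_n {n : ℕ} (d h : Fin n → ℝ) (h0 : LL d h ((n:ℝ) - 1/2) = 1)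
    (hz : ∀ r : ℤ, -(2 * (n:ℤ)) + 2 ≤ r → r ≤ -1 → LL d h (r + ((n:ℝ) - 1/2)) = 0)
    (m : ℕ) :
    chiB n n (2*m) h = Tz (fun r => LL d h (r + ((n:ℝ) - 1/2))) n m := by
  have := chiB_n (n := n) m 0 (by norm_num) h
  rw [add_zero] at this
  rw [this, ← PP_sum _ d h h0 hz n m le_rfl]
  refine Finset.sum_congr rfl fun k _ => ?_
  have := chB_B d h h0 hz (lamk n k) 0
  simpa using this

theorem chi_C_n {n : ℕ} (hn : 1 ≤ n) (d h : Fin n → ℝ) (h0 : LL d h ((n:ℝ) - 1/2) = 1)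
    (hz : ∀ r : ℤ, -(2 * (n:ℤ)) + 2 ≤ r → r ≤ -1 → LL d h (r + ((n:ℝ) - 1/2)) = 0)
    (m : ℕ) :
    chiB n n (2*m+1) h = (∏ k, th (h k)) *
      Tz (fun r => LL (fun k => d k / th (h k)) h (r + (n:ℝ))) n m := by
  obtain ⟨g0, gz⟩ := C_d hn d h h0 hz
  rw [chiB_n (n := n) m 1 (by norm_num) h, ← PP_sum (n:ℝ) _ h g0 (fun r h1 h2 => gz r (by omega) h2) n m le_rfl,
    Finset.mul_sum]
  refine Finset.sum_congr rfl fun k _ => ?_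
  have := chB_B d h h0 hz (lamk n k) (((1:ℕ):ℚ)/2)
  rw [this, QQ_C]
  have e : (n:ℝ) - 1/2 + ((((1:ℕ):ℚ)/2 : ℚ) : ℝ) = n := by push_cast; ring
  rw [e]; ring

end charPart
section dodgson
set_option linter.unusedSimpArgs false

lemma det_C {R : Type} [CommRing R] {N : ℕ} (u w : Fin (N+2) → R) :
    (Matrix.of (fun i j : Fin (N+2) => if j = 0 then u i else if j = Fin.last (N+1) then w i
      else if i = j then 1 else 0)).det = u 0 * w (Fin.last _) - w 0 * u (Fin.last _) := by
  set C := (Matrix.of (fun i j : Fin (N+2) => if j = 0 then u i else if j = Fin.last (N+1) then w i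
      else if i = j then (1:R) else 0)) with hC
  have hl : Fin.last (N+1) ≠ 0 := by simp [Fin.ext_iff]
  rw [Matrix.det_succ_row_zero, Fin.sum_univ_succ, Fin.sum_univ_castSucc]
  have hz : ∀ i : Fin N, C 0 i.castSucc.succ = 0 := by
    intro i
    have := i.2
    simp only [hC, Matrix.of_apply]
    rw [if_neg (by simp [Fin.ext_iff]), if_neg (by simp [Fin.ext_iff]; omega), if_neg (by simp [Fin.ext_iff])]
  have h0 : C 0 0 = u 0 := by simp [hC]
  have h1 : C 0 (Fin.last N).succ = w 0 := by
    simp only [hC, Matrix.of_apply]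
    rw [if_neg (by simp [Fin.ext_iff]), if_pos (by simp [Fin.ext_iff])]
  have d1 : (C.submatrix Fin.succ (Fin.succAbove 0)).det = w (Fin.last _) := by
    rw [Matrix.det_succ_row _ (Fin.last N), Fin.sum_univ_castSucc]
    have a1 : ∀ i : Fin N, (C.submatrix Fin.succ (Fin.succAbove 0)) (Fin.last N) i.castSucc = 0 := by
      intro i
      have := i.2
      simp only [hC, Matrix.submatrix_apply, Matrix.of_apply, Fin.succAbove_zero]
      rw [if_neg (by simp [Fin.ext_iff]), if_neg (by simp [Fin.ext_iff]; omega), if_neg (by simp [Fin.ext_iff]; omega)]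
    have a2 : (C.submatrix Fin.succ (Fin.succAbove 0)) (Fin.last N) (Fin.last N) = w (Fin.last _) := by
      simp only [hC, Matrix.submatrix_apply, Matrix.of_apply, Fin.succAbove_zero]
      rw [if_neg (by simp [Fin.ext_iff]), if_pos (by simp [Fin.ext_iff])]
      simp
    have a3 : ((C.submatrix Fin.succ (Fin.succAbove 0)).submatrix (Fin.last N).succAbove (Fin.last N).succAbove) = 1 := by
      ext i j
      have := j.2
      simp only [hC, Matrix.submatrix_apply, Matrix.of_apply, Fin.succAbove_zero, Fin.succAbove_last]
      rw [if_neg (by simp [Fin.ext_iff]), if_neg (by simp [Fin.ext_iff]; omega), Matrix.one_apply]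
      simp
    simp only [a1, a2, a3]
    simp [← two_mul, pow_mul]
  have d2 : (C.submatrix Fin.succ (Fin.succAbove (Fin.last N).succ)).det = (-1)^N * u (Fin.last _) := by
    rw [Matrix.det_succ_row _ (Fin.last N), Fin.sum_univ_succ]
    have a1 : ∀ i : Fin N, (C.submatrix Fin.succ (Fin.succAbove (Fin.last N).succ)) (Fin.last N) i.succ = 0 := by
      intro i
      have := i.2
      simp only [hC, Matrix.submatrix_apply, Matrix.of_apply, Fin.succ_last, Fin.succAbove_last]
      rw [if_neg (by simp [Fin.ext_iff]), if_neg (by simp [Fin.ext_iff]; omega), if_neg (by simp [Fin.ext_iff]; omega)]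
    have a2 : (C.submatrix Fin.succ (Fin.succAbove (Fin.last N).succ)) (Fin.last N) 0 = u (Fin.last _) := by
      simp [hC]
    have a3 : ((C.submatrix Fin.succ (Fin.succAbove (Fin.last N).succ)).submatrix (Fin.last N).succAbove (Fin.succAbove 0)) = 1 := by
      ext i j
      have := j.2
      simp only [hC, Matrix.submatrix_apply, Matrix.of_apply, Fin.succAbove_zero, Fin.succAbove_last, Fin.succ_last]
      rw [if_neg (by simp [Fin.ext_iff]), if_neg (by simp [Fin.ext_iff]; omega), Matrix.one_apply]
      simp [Fin.ext_iff]
    simp only [a1, a2, a3]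
    simp
  simp only [hz, h0, h1, d1, d2]
  have : ((-1:R))^N * (-1)^N = 1 := by rw [← pow_add, ← two_mul, pow_mul]; simp
  simp
  linear_combination (-(w 0 * u (Fin.last _))) * this

lemma det_D {R : Type} [CommRing R] {N : ℕ} (M : Matrix (Fin (N+2)) (Fin (N+2)) R) (D : R) :
    (Matrix.of (fun i j : Fin (N+2) => if j = 0 then (if i = 0 then D else 0)
      else if j = Fin.last (N+1) then (if i = Fin.last (N+1) then D else 0)
      else M i j)).det = D * (D * (M.submatrix (fun i : Fin N => i.succ.castSucc) (fun i : Fin N => i.succ.castSucc)).det) := by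
  set C := (Matrix.of (fun i j : Fin (N+2) => if j = 0 then (if i = 0 then D else 0)
      else if j = Fin.last (N+1) then (if i = Fin.last (N+1) then D else 0)
      else M i j)) with hC
  rw [Matrix.det_succ_column_zero, Fin.sum_univ_succ]
  have hz : ∀ i : Fin (N+1), C i.succ 0 = 0 := by
    intro i
    simp [hC]
  have h0 : C 0 0 = D := by simp [hC]
  have d1 : (C.submatrix (Fin.succAbove 0) Fin.succ).det
      = D * (M.submatrix (fun i : Fin N => i.succ.castSucc) (fun i : Fin N => i.succ.castSucc)).det := by
    rw [Matrix.det_succ_column _ (Fin.last N), Fin.sum_univ_castSucc]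
    have a1 : ∀ i : Fin N, (C.submatrix (Fin.succAbove 0) Fin.succ) i.castSucc (Fin.last N) = 0 := by
      intro i
      have := i.2
      simp only [hC, Matrix.submatrix_apply, Matrix.of_apply, Fin.succAbove_zero]
      rw [if_neg (by simp [Fin.ext_iff]), if_pos (by simp [Fin.ext_iff]), if_neg (by simp [Fin.ext_iff]; omega)]
    have a2 : (C.submatrix (Fin.succAbove 0) Fin.succ) (Fin.last N) (Fin.last N) = D := by
      simp only [hC, Matrix.submatrix_apply, Matrix.of_apply, Fin.succAbove_zero]
      rw [if_neg (by simp [Fin.ext_iff]), if_pos (by simp [Fin.ext_iff]), if_pos (by simp [Fin.ext_iff])]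
    have a3 : ((C.submatrix (Fin.succAbove 0) Fin.succ).submatrix (Fin.last N).succAbove (Fin.last N).succAbove)
       = (M.submatrix (fun i : Fin N => i.succ.castSucc) (fun i : Fin N => i.succ.castSucc)) := by
      ext i j
      have := j.2
      simp only [hC, Matrix.submatrix_apply, Matrix.of_apply, Fin.succAbove_zero, Fin.succAbove_last]
      rw [if_neg (by simp [Fin.ext_iff]), if_neg (by simp [Fin.ext_iff]; omega)]
      rfl
    simp only [a1, a2, a3]
    simp [← two_mul, pow_mul]
  simp only [hz, h0, d1]
  simp

lemma jacobi_mul {R : Type} [CommRing R] {N : ℕ} (M : Matrix (Fin (N+2)) (Fin (N+2)) R) :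
    M.det * (M.adjugate 0 0 * M.adjugate (Fin.last _) (Fin.last _)
       - M.adjugate 0 (Fin.last _) * M.adjugate (Fin.last _) 0)
     = M.det * (M.det * (M.submatrix (fun i : Fin N => i.succ.castSucc) (fun i : Fin N => i.succ.castSucc)).det) := by
  rw [← det_D, ← det_C (fun i => M.adjugate i 0) (fun i => M.adjugate i (Fin.last _)), ← Matrix.det_mul]
  congr 1
  ext i j
  have hadj : ∀ j, ∑ k, M i k * M.adjugate k j = if i = j then M.det else 0 := by
    intro j
    have := congrFun (congrFun M.mul_adjugate i) j
    rw [Matrix.mul_apply] at this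
    rw [this]
    simp [Matrix.one_apply]
  rw [Matrix.mul_apply]
  simp only [Matrix.of_apply]
  split_ifs with h1 h2 h3 h3
  · rw [hadj, if_pos h2]
  · rw [hadj, if_neg h2]
  · rw [hadj, if_pos h3]
  · rw [hadj, if_neg h3]
  · simp

theorem jacobi {N : ℕ} (M : Matrix (Fin (N+2)) (Fin (N+2)) ℝ) :
    (M.adjugate 0 0 * M.adjugate (Fin.last _) (Fin.last _)
       - M.adjugate 0 (Fin.last _) * M.adjugate (Fin.last _) 0)
     = M.det * (M.submatrix (fun i : Fin N => i.succ.castSucc) (fun i : Fin N => i.succ.castSucc)).det := by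
  set P := Matrix.charmatrix (-M) with hP
  have hne : P.det ≠ 0 := (Matrix.charpoly_monic (-M)).ne_zero
  have h := mul_left_cancel₀ hne (jacobi_mul P)
  have hmap : (Polynomial.evalRingHom (0:ℝ)).mapMatrix P = M := by
    ext i j
    by_cases hij : i = j
    · subst hij; simp [hP]
    · simp [hP, Matrix.charmatrix_apply_ne _ _ _ hij]
  have h2 := congrArg (Polynomial.evalRingHom (0:ℝ)) h
  have hadj : ∀ i j, (Polynomial.evalRingHom (0:ℝ)) (P.adjugate i j) = M.adjugate i j := by
    intro i j
    have := RingHom.map_adjugate (Polynomial.evalRingHom (0:ℝ)) P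
    rw [hmap] at this
    rw [← this]; rfl
  have hsub : (Polynomial.evalRingHom (0:ℝ)) (P.submatrix (fun i : Fin N => i.succ.castSucc) (fun i : Fin N => i.succ.castSucc)).det
     = (M.submatrix (fun i : Fin N => i.succ.castSucc) (fun i : Fin N => i.succ.castSucc)).det := by
    rw [RingHom.map_det]
    congr 1
    rw [← hmap]; rfl
  rw [map_sub, map_mul, map_mul, map_mul, hadj, hadj, hadj, hadj, hsub, RingHom.map_det, hmap] at h2
  exact h2

theorem Tz_dodgson (H : ℤ → ℝ) (a : ℕ) (m : ℤ) :
    (Tz H (a+1) m)^2 = Tz H (a+1) (m-1) * Tz H (a+1) (m+1) + Tz H a m * Tz H (a+2) m := by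
  have h := jacobi (Matrix.of (fun j i : Fin (a+2) => H (m - (j:ℕ) + (i:ℕ))))
  simp only [Matrix.adjugate_fin_succ_eq_det_submatrix] at h
  have e1 : ((Matrix.of (fun j i : Fin (a+2) => H (m - (j:ℕ) + (i:ℕ)))).submatrix (Fin.succAbove 0) (Fin.succAbove 0)).det = Tz H (a+1) m := by
    unfold Tz; congr 1; ext i j
    simp; congr 1; ring
  have e2 : ((Matrix.of (fun j i : Fin (a+2) => H (m - (j:ℕ) + (i:ℕ)))).submatrix (Fin.succAbove (Fin.last _)) (Fin.succAbove (Fin.last _))).det = Tz H (a+1) m := by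
    unfold Tz; congr 1; ext i j
    simp
  have e3 : ((Matrix.of (fun j i : Fin (a+2) => H (m - (j:ℕ) + (i:ℕ)))).submatrix (Fin.succAbove (Fin.last _)) (Fin.succAbove 0)).det = Tz H (a+1) (m+1) := by
    unfold Tz; congr 1; ext i j
    simp; congr 1; ring
  have e4 : ((Matrix.of (fun j i : Fin (a+2) => H (m - (j:ℕ) + (i:ℕ)))).submatrix (Fin.succAbove 0) (Fin.succAbove (Fin.last _))).det = Tz H (a+1) (m-1) := by
    unfold Tz; congr 1; ext i j
    simp; congr 1; ring
  have e5 : ((Matrix.of (fun j i : Fin (a+2) => H (m - (j:ℕ) + (i:ℕ)))).submatrix (fun i : Fin a => i.succ.castSucc) (fun i : Fin a => i.succ.castSucc)).det = Tz H a m := by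
    unfold Tz; congr 1; ext i j
    simp; congr 1; ring
  have e6 : (Matrix.of (fun j i : Fin (a+2) => H (m - (j:ℕ) + (i:ℕ)))).det = Tz H (a+2) m := rfl
  rw [e1, e2, e3, e4, e5, e6] at h
  have s : ((-1:ℝ))^(a+1) * (-1)^(a+1) = 1 := by rw [← pow_add, ← two_mul, pow_mul]; simp
  simp at h
  linear_combination h + (Tz H (a+1) (m+1) * Tz H (a+1) (m-1)) * s

end dodgson
section factor
set_option linter.unusedSimpArgs false

noncomputable def cc (p t : ℝ) : ℝ := Real.exp (p * t) + Real.exp (-(p * t))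

lemma vv_cc (p q t : ℝ) : vv p t * cc q t = vv (p+q) t + vv (p-q) t := by
  unfold vv cc
  simp only [mul_add, sub_mul, ← Real.exp_add]
  ring_nf

noncomputable def FF {n : ℕ} (h : Fin n → ℝ) (f : ℝ) : ℝ :=
  (Matrix.of (fun k j : Fin n => vv (f + (j:ℕ)) (h k))).det

noncomputable def GG {N : ℕ} (h : Fin (N+1) → ℝ) (g : ℝ) : ℝ :=
  (Matrix.of (fun k i : Fin (N+1) => cc (g + ((N:ℝ) - (i:ℕ))) (h k))).det

lemma FG {N : ℕ} (d h : Fin (N+1) → ℝ) (f g : ℝ) :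
    FF h f * GG h g * ∏ k, d k = (Matrix.of (fun j i : Fin (N+1) =>
      LL d h ((f + (j:ℕ)) + (g + ((N:ℝ) - (i:ℕ)))) + LL d h ((f + (j:ℕ)) - (g + ((N:ℝ) - (i:ℕ)))))).det := by
  have e := Matrix.det_mul_column d (Matrix.of (fun k i : Fin (N+1) => cc (g + ((N:ℝ) - (i:ℕ))) (h k)))
  rw [mul_assoc, mul_comm (GG h g), GG, ← e, FF, ← Matrix.det_transpose, ← Matrix.det_mul]
  congr 1
  ext j i
  rw [Matrix.mul_apply]
  simp only [LL, Matrix.of_apply, Matrix.transpose_apply]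
  rw [← Finset.sum_add_distrib]
  refine Finset.sum_congr rfl fun k _ => ?_
  rw [← mul_add, ← vv_cc]; ring

lemma Tz_tr (H : ℤ → ℝ) (a : ℕ) (m : ℤ) :
    Tz H a m = (Matrix.of (fun j i : Fin a => H (m + (j:ℕ) - (i:ℕ)))).det := by
  unfold Tz
  rw [← Matrix.det_transpose]
  congr 1
  ext j i
  simp; congr 1; ring

lemma det_corner_last (H : ℤ → ℝ) (N : ℕ) (m : ℤ) :
    (Matrix.of (fun j i : Fin (N+1) => H (m + (j:ℕ) - (i:ℕ)) + if (j:ℕ) + (i:ℕ) = 2 * N then 1 else 0)).det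
     = Tz H (N+1) m + Tz H N m := by
  rw [Tz_tr, Tz_tr, Matrix.det_succ_row _ (Fin.last N), Matrix.det_succ_row _ (Fin.last N)]
  have e : ∀ i : Fin (N+1), (Matrix.of (fun j i : Fin (N+1) => H (m + (j:ℕ) - (i:ℕ)) + if (j:ℕ) + (i:ℕ) = 2 * N then 1 else 0)).submatrix (Fin.last N).succAbove i.succAbove
     = (Matrix.of (fun j i : Fin (N+1) => H (m + (j:ℕ) - (i:ℕ)))).submatrix (Fin.last N).succAbove i.succAbove := by
    intro i
    ext j k
    have := j.2
    have := (i.succAbove k).2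
    simp only [Matrix.submatrix_apply, Matrix.of_apply, Fin.succAbove_last, Fin.val_castSucc]
    rw [if_neg (by omega), add_zero]
  simp only [e]
  rw [Fin.sum_univ_castSucc, Fin.sum_univ_castSucc, add_assoc]
  congr 1
  · refine Finset.sum_congr rfl fun i _ => ?_
    have := i.2
    simp only [Matrix.of_apply, Fin.val_last, Fin.val_castSucc]
    rw [if_neg (by omega), add_zero]
  · have e2 : (Matrix.of (fun j i : Fin (N+1) => H (m + (j:ℕ) - (i:ℕ)))).submatrix (Fin.last N).succAbove (Fin.last N).succAbove
     = (Matrix.of (fun j i : Fin N => H (m + (j:ℕ) - (i:ℕ)))) := by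
      ext i j; simp
    rw [e2]
    simp only [Matrix.of_apply, Fin.val_last]
    rw [if_pos (by omega)]
    have s : ((-1:ℝ))^(N+N) = 1 := by rw [← two_mul, pow_mul]; simp
    rw [s]; ring

lemma det_corner_zero (H : ℤ → ℝ) (N : ℕ) (m : ℤ) :
    (Matrix.of (fun j i : Fin (N+1) => H (m + (j:ℕ) - (i:ℕ)) - if (j:ℕ) + (i:ℕ) = 0 then 1 else 0)).det
     = Tz H (N+1) m - Tz H N m := by
  rw [Tz_tr, Tz_tr, Matrix.det_succ_row _ 0, Matrix.det_succ_row _ 0]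
  have e : ∀ i : Fin (N+1), (Matrix.of (fun j i : Fin (N+1) => H (m + (j:ℕ) - (i:ℕ)) - if (j:ℕ) + (i:ℕ) = 0 then 1 else 0)).submatrix (Fin.succAbove 0) i.succAbove
     = (Matrix.of (fun j i : Fin (N+1) => H (m + (j:ℕ) - (i:ℕ)))).submatrix (Fin.succAbove 0) i.succAbove := by
    intro i
    ext j k
    simp only [Matrix.submatrix_apply, Matrix.of_apply, Fin.succAbove_zero, Fin.val_succ]
    rw [if_neg (by omega), sub_zero]
  simp only [e]
  rw [Fin.sum_univ_succ, Fin.sum_univ_succ]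
  have e2 : (Matrix.of (fun j i : Fin (N+1) => H (m + (j:ℕ) - (i:ℕ)))).submatrix (Fin.succAbove 0) (Fin.succAbove 0)
     = (Matrix.of (fun j i : Fin N => H (m + (j:ℕ) - (i:ℕ)))) := by
      ext i j; simp; congr 1; ring
  rw [e2]
  have e3 : ∀ i : Fin N, (Matrix.of (fun j i : Fin (N+1) => H (m + (j:ℕ) - (i:ℕ)) - if (j:ℕ) + (i:ℕ) = 0 then 1 else 0)) 0 i.succ
     = (Matrix.of (fun j i : Fin (N+1) => H (m + (j:ℕ) - (i:ℕ)))) 0 i.succ := by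
    intro i; simp
  simp only [e3]
  simp; ring

theorem FG_plus {N : ℕ} (d h : Fin (N+1) → ℝ) (s : ℝ) (h0 : LL d h s = 1)
    (hz : ∀ r : ℤ, -(2 * (N:ℤ)) ≤ r → r ≤ -1 → LL d h (r + s) = 0) (m : ℤ) (f g : ℝ)
    (h1 : f + g + N = m + s) (h2 : f - g = s - N) :
    FF h f * GG h g * ∏ k, d k = Tz (fun r => LL d h (r + s)) (N+1) m + Tz (fun r => LL d h (r + s)) N m := by
  rw [FG, ← det_corner_last]
  congr 1
  ext j i
  have := j.2
  have := i.2
  simp only [Matrix.of_apply]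
  congr 1
  · congr 1; push_cast; linear_combination h1
  · have e : (f + (j:ℕ)) - (g + ((N:ℝ) - (i:ℕ))) = (((j:ℕ) + (i:ℕ) - 2 * N : ℤ):ℝ) + s := by
      push_cast; linear_combination h2
    rw [e]
    split_ifs with hij
    · rw [← h0]; congr 1
      have : ((j:ℕ) + (i:ℕ) - 2 * N : ℤ) = 0 := by omega
      rw [this]; simp
    · apply hz <;> omega

theorem FG_minus {N : ℕ} (d h : Fin (N+1) → ℝ) (s : ℝ) (h0 : LL d h s = 1)
    (hz : ∀ r : ℤ, -(2 * (N:ℤ)) ≤ r → r ≤ -1 → LL d h (r + s) = 0) (m : ℤ) (f g : ℝ)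
    (h1 : f + g + N = m + s) (h2 : f - g = N - s) :
    FF h f * GG h g * ∏ k, d k = Tz (fun r => LL d h (r + s)) (N+1) m - Tz (fun r => LL d h (r + s)) N m := by
  rw [FG, ← det_corner_zero]
  congr 1
  ext j i
  have := j.2
  have := i.2
  simp only [Matrix.of_apply]
  refine Eq.trans ?_ (sub_eq_add_neg _ _).symm
  congr 1
  · congr 1; push_cast; linear_combination h1
  · have e : (f + (j:ℕ)) - (g + ((N:ℝ) - (i:ℕ))) = -(((-((j:ℕ) + (i:ℕ)) : ℤ):ℝ) + s) := by
      push_cast; linear_combination h2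
    rw [e, LL_neg]
    congr 1
    split_ifs with hij
    · rw [← h0]; congr 1
      have : (-((j:ℕ) + (i:ℕ)) : ℤ) = 0 := by omega
      rw [this]; simp
    · apply hz <;> omega

theorem FG_zero {N : ℕ} (d h : Fin (N+1) → ℝ) (s : ℝ) (hs : s = N + 1)
    (hz : ∀ r : ℤ, -(2 * (N:ℤ)) - 1 ≤ r → r ≤ -1 → LL d h (r + s) = 0) (m : ℤ) (f : ℝ)
    (h1 : f + f + N = m + s) :
    FF h f * GG h f * ∏ k, d k = Tz (fun r => LL d h (r + s)) (N+1) m := by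
  rw [FG, Tz_tr]
  congr 1
  ext j i
  have := j.2
  have := i.2
  simp only [Matrix.of_apply]
  have e : (f + (j:ℕ)) - (f + ((N:ℝ) - (i:ℕ))) = (((j:ℕ) + (i:ℕ) - 2 * N - 1 : ℤ):ℝ) + s := by
    push_cast; linear_combination -hs
  rw [e, hz, add_zero]
  · congr 1; push_cast; linear_combination h1
  · omega
  · omega

end factor

section final

theorem main_thm (n : ℕ) (hn : 2 ≤ n) (h : Fin n → ℝ)
    (hden : anum n (rhoB n) h ≠ 0) :
    (∀ a : ℕ, 1 ≤ a → a ≤ n - 2 → ∀ j : ℕ, 1 ≤ j →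
      (chiB n a j h)^2
        = chiB n a (j-1) h * chiB n a (j+1) h + chiB n (a-1) j h * chiB n (a+1) j h)
    ∧ (∀ j : ℕ, 1 ≤ j →
      (chiB n (n-1) j h)^2
        = chiB n (n-1) (j-1) h * chiB n (n-1) (j+1) h
          + chiB n (n-2) j h * chiB n n (2*j) h)
    ∧ (∀ j : ℕ, 1 ≤ j →
      (chiB n n (2*j) h)^2
        = chiB n n (2*j-1) h * chiB n n (2*j+1) h + (chiB n (n-1) j h)^2)
    ∧ (∀ j : ℕ,
      (chiB n n (2*j+1) h)^2
        = chiB n n (2*j) h * chiB n n (2*j+2) h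
          + chiB n (n-1) j h * chiB n (n-1) (j+1) h) := by
  obtain ⟨N, rfl⟩ : ∃ N, n = N + 1 := ⟨n - 1, by omega⟩
  obtain ⟨d, h0, hz⟩ := exists_d (by omega) h hden
  obtain ⟨g0, gz⟩ := C_d (by omega) d h h0 hz
  have lt := fun a m ha => chi_B d h h0 hz a m ha
  have en := fun m => chi_B_n d h h0 hz m
  have cn := fun m => chi_C_n (by omega) d h h0 hz m
  set S := (fun r : ℤ => LL d h (r + (((N+1:ℕ):ℝ) - 1/2))) with hS
  set e := (fun k => d k / th (h k)) with he
  set U := (fun r : ℤ => LL e h (r + ((N+1:ℕ):ℝ))) with hU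
  set D := ∏ k, d k with hD
  have hDe : (∏ k, th (h k)) * ∏ k, e k = D := by
    rw [← Finset.prod_mul_distrib]
    refine Finset.prod_congr rfl fun k _ => ?_
    have := (th_pos (h k)).ne'
    simp only [he]; field_simp
  have hz2 : ∀ r : ℤ, -(2 * (N:ℤ)) ≤ r → r ≤ -1 → LL d h (r + (((N+1:ℕ):ℝ) - 1/2)) = 0 :=
    fun r h1 h2 => hz r (by push_cast; omega) h2
  have gz2 : ∀ r : ℤ, -(2 * (N:ℤ)) - 1 ≤ r → r ≤ -1 → LL e h (r + ((N+1:ℕ):ℝ)) = 0 :=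
    fun r h1 h2 => gz r (by push_cast; omega) h2
  have p1 : ∀ m : ℤ, FF h (((m:ℝ)+1)/2) * GG h ((m:ℝ)/2) * D = Tz S (N+1) m + Tz S N m := fun m =>
    FG_plus d h _ h0 hz2 m _ _ (by push_cast; ring) (by push_cast; ring)
  have p2 : ∀ m : ℤ, FF h ((m:ℝ)/2) * GG h (((m:ℝ)+1)/2) * D = Tz S (N+1) m - Tz S N m := fun m =>
    FG_minus d h _ h0 hz2 m _ _ (by push_cast; ring) (by push_cast; ring)
  have p3 : ∀ m : ℤ, FF h (((m:ℝ)+1)/2) * GG h (((m:ℝ)+1)/2) * D = (∏ k, th (h k)) * Tz U (N+1) m := fun m => by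
    have := FG_zero e h _ (by push_cast; ring) gz2 m (((m:ℝ)+1)/2) (by push_cast; ring)
    rw [← this, ← hDe]; ring
  have p4 : ∀ m : ℤ, FF h (((m:ℝ)+2)/2) * GG h ((m:ℝ)/2) * D = (∏ k, th (h k)) * (Tz U (N+1) m + Tz U N m) := fun m => by
    have := FG_plus e h _ g0 (fun r h1 h2 => gz2 r (by omega) h2) m (((m:ℝ)+2)/2) ((m:ℝ)/2) (by push_cast; ring) (by push_cast; ring)
    rw [← this, ← hDe]; ring
  have p5 : ∀ m : ℤ, FF h ((m:ℝ)/2) * GG h (((m:ℝ)+2)/2) * D = (∏ k, th (h k)) * (Tz U (N+1) m - Tz U N m) := fun m => by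
    have := FG_minus e h _ g0 (fun r h1 h2 => gz2 r (by omega) h2) m ((m:ℝ)/2) (((m:ℝ)+2)/2) (by push_cast; ring) (by push_cast; ring)
    rw [← this, ← hDe]; ring
  refine ⟨?_, ?_, ?_, ?_⟩
  · intro a h1 h2 j hj
    obtain ⟨b, rfl⟩ : ∃ b, a = b + 1 := ⟨a - 1, by omega⟩
    obtain ⟨i, rfl⟩ : ∃ i, j = i + 1 := ⟨j - 1, by omega⟩
    simp only [Nat.add_sub_cancel]
    rw [lt _ _ (by omega), lt _ _ (by omega), lt _ _ (by omega), lt _ _ (by omega), lt _ _ (by omega), Tz_dodgson]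
    congr 3 <;> push_cast <;> ring
  · intro j hj
    obtain ⟨b, rfl⟩ : ∃ b, N = b + 1 := ⟨N - 1, by omega⟩
    obtain ⟨i, rfl⟩ : ∃ i, j = i + 1 := ⟨j - 1, by omega⟩
    have eb : b + 1 + 1 - 2 = b := by omega
    simp only [Nat.add_sub_cancel, eb]
    rw [lt _ _ (by omega), lt _ _ (by omega), lt _ _ (by omega), lt _ _ (by omega), en, Tz_dodgson]
    congr 3 <;> push_cast <;> ring
  · intro j hj
    obtain ⟨i, rfl⟩ : ∃ i, j = i + 1 := ⟨j - 1, by omega⟩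
    have eb : 2 * (i+1) - 1 = 2 * i + 1 := by omega
    simp only [Nat.add_sub_cancel, eb]
    rw [lt N _ (by omega), en, cn, cn]
    have q1 := p1 ((i+1:ℕ):ℤ)
    have q2 := p2 ((i+1:ℕ):ℤ)
    have q3 := p3 ((i+1:ℕ):ℤ)
    have q4 := p3 ((i:ℕ):ℤ)
    rw [← q3, ← q4]
    have e1 : (((i:ℕ):ℤ):ℝ) + 1 = (((i+1:ℕ):ℤ):ℝ) := by push_cast; ring
    rw [e1]
    linear_combination (-(Tz S (N+1) ((i+1:ℕ):ℤ) - Tz S N ((i+1:ℕ):ℤ))) * q1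
      - (FF h (((((i+1:ℕ):ℤ):ℝ)+1)/2) * GG h ((((i+1:ℕ):ℤ):ℝ)/2) * D) * q2
  · intro j
    have eb : 2 * j + 2 = 2 * (j+1) := by omega
    simp only [Nat.add_sub_cancel, eb]
    rw [lt N _ (by omega), lt N _ (by omega), en, en, cn]
    have q1 := p1 ((j:ℕ):ℤ)
    have q2 := p2 ((j:ℕ):ℤ)
    have q3 := p1 ((j+1:ℕ):ℤ)
    have q4 := p2 ((j+1:ℕ):ℤ)
    have q5 := p3 ((j:ℕ):ℤ)
    have q6 := p4 ((j:ℕ):ℤ)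
    have q7 := p5 ((j:ℕ):ℤ)
    have e1 : (((j+1:ℕ):ℤ):ℝ) = (((j:ℕ):ℤ):ℝ) + 1 := by push_cast; ring
    have e2 : (((j:ℕ):ℤ):ℝ) + 1 + 1 = (((j:ℕ):ℤ):ℝ) + 2 := by ring
    rw [e1, e2] at q3 q4
    generalize FF h (((((j:ℕ):ℤ):ℝ)+1)/2) = F1 at *
    generalize GG h (((((j:ℕ):ℤ):ℝ)+1)/2) = G1 at *
    generalize FF h (((((j:ℕ):ℤ):ℝ)+2)/2) = F2 at *
    generalize GG h (((((j:ℕ):ℤ):ℝ)+2)/2) = G2 at *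
    generalize FF h (((((j:ℕ):ℤ):ℝ))/2) = F0 at *
    generalize GG h (((((j:ℕ):ℤ):ℝ))/2) = G0 at *
    generalize Tz S (N+1) ((j:ℕ):ℤ) = A at *
    generalize Tz S N ((j:ℕ):ℤ) = B at *
    generalize Tz S (N+1) ((j+1:ℕ):ℤ) = A' at *
    generalize Tz S N ((j+1:ℕ):ℤ) = B' at *
    generalize Tz U (N+1) ((j:ℕ):ℤ) = C at *
    generalize Tz U N ((j:ℕ):ℤ) = E at *
    generalize (∏ k, th (h k)) = t at *
    have hA : A = (F1*G0*D + F0*G1*D)/2 := by linear_combination (-q1-q2)/2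
    have hB : B = (F1*G0*D - F0*G1*D)/2 := by linear_combination (-q1+q2)/2
    have hA' : A' = (F2*G1*D + F1*G2*D)/2 := by linear_combination (-q3-q4)/2
    have hB' : B' = (F2*G1*D - F1*G2*D)/2 := by linear_combination (-q3+q4)/2
    have hC : F2*G0*D + F0*G2*D = 2 * (F1*G1*D) := by linear_combination q6 + q7 - 2 * q5
    rw [← q5, hA, hB, hA', hB']
    linear_combination (-(F1*G1*D)/2) * hC

end final
/-- (Theorem: the `χ^{(a)}_j` of type `B_n` satisfy the `Q`-system of
type `B_n`), as an identity of characters, i.e. of the corresponding functions on the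
set where the Weyl denominator does not vanish.  Here `χ^{(0)}_j = 1` and
`χ^{(a)}_0 = 1` (these hold by definition of `chiB`). -/
theorem statement7 (n : ℕ) (hn : 2 ≤ n) (h : Fin n → ℝ)
    (hden : anum n (rhoB n) h ≠ 0) :
    (∀ a : ℕ, 1 ≤ a → a ≤ n - 2 → ∀ j : ℕ, 1 ≤ j →
      (chiB n a j h)^2
        = chiB n a (j-1) h * chiB n a (j+1) h + chiB n (a-1) j h * chiB n (a+1) j h)
    ∧ (∀ j : ℕ, 1 ≤ j →
      (chiB n (n-1) j h)^2
        = chiB n (n-1) (j-1) h * chiB n (n-1) (j+1) h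
          + chiB n (n-2) j h * chiB n n (2*j) h)
    ∧ (∀ j : ℕ, 1 ≤ j →
      (chiB n n (2*j) h)^2
        = chiB n n (2*j-1) h * chiB n n (2*j+1) h + (chiB n (n-1) j h)^2)
    ∧ (∀ j : ℕ,
      (chiB n n (2*j+1) h)^2
        = chiB n n (2*j) h * chiB n n (2*j+2) h
          + chiB n (n-1) j h * chiB n (n-1) (j+1) h) := by
  exact main_thm n hn h hden

end FermionicPaperBn
end
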